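/- Let (R, m) be a commutative Noetherian local ring. Then the following are equivalent: (i) R is a Gorenstein ring; (ii) the Gorenstein injective dimension Gid_R(H^n_𝔞(R)) is finite for all proper ideals 𝔞 of R such that R is relative Cohen-Macaulay with respect to 𝔞 with ht_R 𝔞 = n; (iii) Gid_R(H^n_𝔞(R)) is finite for some proper ideal 𝔞 of R such that R is relative Cohen-Macaulay with respect to 𝔞 with ht_R 𝔞 = n. -/

import Mathlib

/-!
Definitions needed to state results of "On flat and Gorenstein flat dimensions of
local cohomology modules" by M.R. Zargar and H. Zakeri.
-/

open CategoryTheory IsLocalRing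

universe u

namespace Paper

variable (R : Type u) [CommRing R]

/-! ## Resolution/coresolution dimensions with respect to a class of modules -/

/-- `ResDimLE R P n M` : `M` admits a resolution `0 → Xₙ → ⋯ → X₀ → M → 0`
with each `Xᵢ` in the class `P`. -/
def ResDimLE (P : ModuleCat.{u} R → Prop) : ℕ → ModuleCat.{u} R → Prop
  | 0, M => P M
  | n + 1, M => ResDimLE P n M ∨
      ∃ (X : ModuleCat.{u} R) (f : X →ₗ[R] M), P X ∧ Function.Surjective f ∧
        ResDimLE P n (ModuleCat.of R (LinearMap.ker f))

/-- `CoresDimLE R P n M` : `M` admits a coresolution `0 → M → X₀ → ⋯ → Xₙ → 0`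
with each `Xᵢ` in the class `P`. -/
def CoresDimLE (P : ModuleCat.{u} R → Prop) : ℕ → ModuleCat.{u} R → Prop
  | 0, M => P M
  | n + 1, M => CoresDimLE P n M ∨
      ∃ (X : ModuleCat.{u} R) (f : M →ₗ[R] X), P X ∧ Function.Injective f ∧
        CoresDimLE P n (ModuleCat.of R (X ⧸ LinearMap.range f))

/-- The resolution dimension of `M` with respect to the class `P`, as an
extended natural number (`⊤` if there is no finite resolution). -/
noncomputable def ResDim (P : ModuleCat.{u} R → Prop) (M : ModuleCat.{u} R) : ℕ∞ :=
  sInf {n : ℕ∞ | ∃ k : ℕ, (k : ℕ∞) = n ∧ ResDimLE R P k M}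

/-- The coresolution dimension of `M` with respect to the class `P`. -/
noncomputable def CoresDim (P : ModuleCat.{u} R → Prop) (M : ModuleCat.{u} R) : ℕ∞ :=
  sInf {n : ℕ∞ | ∃ k : ℕ, (k : ℕ∞) = n ∧ CoresDimLE R P k M}

/-- Flat dimension `fd_R M`. -/
noncomputable def flatDim (M : Type u) [AddCommGroup M] [Module R M] : ℕ∞ :=
  ResDim R (fun N => Module.Flat R N) (ModuleCat.of R M)

/-- Projective dimension `pd_R M`. -/
noncomputable def projDim (M : Type u) [AddCommGroup M] [Module R M] : ℕ∞ :=
  ResDim R (fun N => Module.Projective R N) (ModuleCat.of R M)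

/-- Injective dimension `id_R M`. -/
noncomputable def injDim (M : Type u) [AddCommGroup M] [Module R M] : ℕ∞ :=
  CoresDim R (fun N => Module.Injective R N) (ModuleCat.of R M)

/-! ## Local cohomology -/

/-- The local cohomology module `H^i_𝔞(M)`, as an object of `ModuleCat R`. -/
noncomputable def lcoh (𝔞 : Ideal R) (i : ℕ) (M : Type u) [AddCommGroup M] [Module R M] :
    ModuleCat.{u} R :=
  (localCohomology 𝔞 i).obj (ModuleCat.of R M)

/-- `M` is relative Cohen-Macaulay with respect to `𝔞` with `ht_M 𝔞 = n`, i.e. the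
`n`-th local cohomology of `M` with respect to `𝔞` is the only non-vanishing one. -/
def IsRelCM (𝔞 : Ideal R) (n : ℕ) (M : Type u) [AddCommGroup M] [Module R M] : Prop :=
  (∀ i : ℕ, i ≠ n → Subsingleton (lcoh R 𝔞 i M)) ∧ ¬ Subsingleton (lcoh R 𝔞 n M)

/-! ## Depth, dimension, Cohen-Macaulay -/

/-- The depth of a module over a local ring: the supremum of the lengths of
`M`-regular sequences contained in the maximal ideal. -/
noncomputable def depth [IsLocalRing R] (M : Type u) [AddCommGroup M] [Module R M] : ℕ∞ :=
  sSup {n : ℕ∞ | ∃ rs : List R, (rs.length : ℕ∞) = n ∧ (∀ x ∈ rs, x ∈ maximalIdeal R) ∧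
    RingTheory.Sequence.IsRegular M rs}

/-- The (Krull) dimension of a module: the Krull dimension of `R` modulo
the annihilator of `M` (`⊥` for the zero module). -/
noncomputable def moduleDim (M : Type u) [AddCommGroup M] [Module R M] : WithBot ℕ∞ :=
  ringKrullDim (R ⧸ Module.annihilator R M)

/-- A finitely generated module over a local ring is Cohen-Macaulay
if its depth equals its dimension. -/
def IsCohenMacaulayModule [IsLocalRing R] (M : Type u) [AddCommGroup M] [Module R M] : Prop :=
  (depth R M : WithBot ℕ∞) = moduleDim R M

/-- A local ring is Cohen-Macaulay if it is so as a module over itself. -/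
def IsCohenMacaulayRing [IsLocalRing R] : Prop := IsCohenMacaulayModule R R

/-- A local ring is Gorenstein if it has finite injective dimension over itself. -/
def IsGorensteinRing : Prop := injDim R R ≠ ⊤

/-! ## Ext, Tor, semidualizing modules -/

/-- `Ext^i_R(A, B)`. -/
noncomputable def ext (i : ℕ) (A B : Type u) [AddCommGroup A] [Module R A]
    [AddCommGroup B] [Module R B] : ModuleCat.{u} R :=
  ((Ext R (ModuleCat.{u} R) i).obj (Opposite.op (ModuleCat.of R A))).obj (ModuleCat.of R B)

/-- `Tor^R_p(A, B)` indexed by `p : ℤ`, with the convention that it vanishes in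
negative degrees. -/
noncomputable def tor (p : ℤ) (A B : Type u) [AddCommGroup A] [Module R A]
    [AddCommGroup B] [Module R B] : ModuleCat.{u} R :=
  if 0 ≤ p then ((Tor (ModuleCat.{u} R) p.toNat).obj (ModuleCat.of R A)).obj (ModuleCat.of R B)
  else ModuleCat.of R PUnit

/-- A finitely generated module `C` is semidualizing if the natural map
`R → Hom_R(C, C)` is bijective and `Ext^i_R(C, C) = 0` for all `i ≥ 1`. -/
def IsSemidualizing (C : Type u) [AddCommGroup C] [Module R C] : Prop :=
  Module.Finite R C ∧
  Function.Bijective (fun r : R => (r • LinearMap.id : C →ₗ[R] C)) ∧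
  ∀ i : ℕ, 1 ≤ i → Subsingleton (ext R i C C)

/-! ## Gorenstein homological classes -/

/-- `N` is Gorenstein injective: it is the kernel of the `0`-th differential of some
exact complex `Y` of injective modules which stays exact under `Hom(I, -)` for every
injective module `I`. (The complex is written cohomologically.) -/
def IsGorensteinInjective (N : Type u) [AddCommGroup N] [Module R N] : Prop :=
  ∃ (Y : ℤ → ModuleCat.{u} R) (d : ∀ i : ℤ, Y i →ₗ[R] Y (i + 1)),
    (∀ i, Module.Injective R (Y i)) ∧
    (∀ i, Function.Exact (d i) (d (i + 1))) ∧
    (∀ (I : ModuleCat.{u} R), Module.Injective R I →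
      ∀ (i : ℤ) (g : I →ₗ[R] Y (i + 1)), (d (i + 1)).comp g = 0 →
        ∃ h : I →ₗ[R] Y i, (d i).comp h = g) ∧
    ∃ ι : N →ₗ[R] Y 0, Function.Injective ι ∧ Function.Exact ι (d 0)

/-- `N` is Gorenstein projective: it is the cokernel of a differential of some
exact complex `X` of projective modules which stays exact under `Hom(-, P)` for
every projective module `P`. -/
def IsGorensteinProjective (N : Type u) [AddCommGroup N] [Module R N] : Prop :=
  ∃ (X : ℤ → ModuleCat.{u} R) (d : ∀ i : ℤ, X i →ₗ[R] X (i + 1)),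
    (∀ i, Module.Projective R (X i)) ∧
    (∀ i, Function.Exact (d i) (d (i + 1))) ∧
    (∀ (P : ModuleCat.{u} R), Module.Projective R P →
      ∀ (i : ℤ) (g : X (i + 1) →ₗ[R] P), g.comp (d i) = 0 →
        ∃ h : X (i + 1 + 1) →ₗ[R] P, h.comp (d (i + 1)) = g) ∧
    ∃ π : X 0 →ₗ[R] N, Function.Surjective π ∧ Function.Exact (d (-1)) π

/-- `N` is Gorenstein flat: it is the cokernel of a differential of some exact
complex `Z` of flat modules which stays exact under `- ⊗ I` for every injective
module `I`. -/
def IsGorensteinFlat (N : Type u) [AddCommGroup N] [Module R N] : Prop :=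
  ∃ (Z : ℤ → ModuleCat.{u} R) (d : ∀ i : ℤ, Z i →ₗ[R] Z (i + 1)),
    (∀ i, Module.Flat R (Z i)) ∧
    (∀ i, Function.Exact (d i) (d (i + 1))) ∧
    (∀ (I : ModuleCat.{u} R), Module.Injective R I →
      ∀ i : ℤ, Function.Exact (LinearMap.rTensor (R := R) I (d i))
        (LinearMap.rTensor (R := R) I (d (i + 1)))) ∧
    ∃ π : Z 0 →ₗ[R] N, Function.Surjective π ∧ Function.Exact (d (-1)) π

/-- Gorenstein injective dimension `Gid_R M`. -/
noncomputable def GinjDim (M : Type u) [AddCommGroup M] [Module R M] : ℕ∞ :=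
  CoresDim R (fun N => IsGorensteinInjective R N) (ModuleCat.of R M)

/-- Gorenstein projective dimension `Gpd_R M`. -/
noncomputable def GprojDim (M : Type u) [AddCommGroup M] [Module R M] : ℕ∞ :=
  ResDim R (fun N => IsGorensteinProjective R N) (ModuleCat.of R M)

/-- Gorenstein flat dimension `Gfd_R M`. -/
noncomputable def GflatDim (M : Type u) [AddCommGroup M] [Module R M] : ℕ∞ :=
  ResDim R (fun N => IsGorensteinFlat R N) (ModuleCat.of R M)

/-! ## `C`-injective, `C`-projective, `C`-flat modules and the `G_C`-classes -/

/-- `N` is `C`-injective if `N ≅ Hom_R(C, I)` for some injective module `I`. -/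
def IsCInjective (C : Type u) [AddCommGroup C] [Module R C]
    (N : Type u) [AddCommGroup N] [Module R N] : Prop :=
  ∃ I : ModuleCat.{u} R, Module.Injective R I ∧ Nonempty (N ≃ₗ[R] (C →ₗ[R] I))

/-- `N` is `C`-projective if `N ≅ C ⊗_R P` for some projective module `P`. -/
def IsCProjective (C : Type u) [AddCommGroup C] [Module R C]
    (N : Type u) [AddCommGroup N] [Module R N] : Prop :=
  ∃ P : ModuleCat.{u} R, Module.Projective R P ∧ Nonempty (N ≃ₗ[R] TensorProduct R C P)

/-- `N` is `C`-flat if `N ≅ C ⊗_R F` for some flat module `F`. -/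
def IsCFlat (C : Type u) [AddCommGroup C] [Module R C]
    (N : Type u) [AddCommGroup N] [Module R N] : Prop :=
  ∃ F : ModuleCat.{u} R, Module.Flat R F ∧ Nonempty (N ≃ₗ[R] TensorProduct R C F)

/-- `C`-injective dimension `cid_R M`. -/
noncomputable def cInjDim (C : Type u) [AddCommGroup C] [Module R C]
    (M : Type u) [AddCommGroup M] [Module R M] : ℕ∞ :=
  CoresDim R (fun N => IsCInjective R C N) (ModuleCat.of R M)

/-- `C`-projective dimension `cpd_R M`. -/
noncomputable def cProjDim (C : Type u) [AddCommGroup C] [Module R C]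
    (M : Type u) [AddCommGroup M] [Module R M] : ℕ∞ :=
  ResDim R (fun N => IsCProjective R C N) (ModuleCat.of R M)

/-- `N` is `G_C`-injective: `N` is the kernel of the `0`-th differential of an exact
complex `Y` (a complete `I_C I`-coresolution) with `Y i` injective in degrees belonging
to the coresolution part and `C`-injective elsewhere, such that `Hom(I', Y)` is exact
for every `C`-injective module `I'`. -/
def IsGCInjective (C : Type u) [AddCommGroup C] [Module R C]
    (N : Type u) [AddCommGroup N] [Module R N] : Prop :=
  ∃ (Y : ℤ → ModuleCat.{u} R) (d : ∀ i : ℤ, Y i →ₗ[R] Y (i + 1)),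
    (∀ i : ℤ, 0 ≤ i → Module.Injective R (Y i)) ∧
    (∀ i : ℤ, i < 0 → IsCInjective R C (Y i)) ∧
    (∀ i, Function.Exact (d i) (d (i + 1))) ∧
    (∀ (I : ModuleCat.{u} R), IsCInjective R C I →
      ∀ (i : ℤ) (g : I →ₗ[R] Y (i + 1)), (d (i + 1)).comp g = 0 →
        ∃ h : I →ₗ[R] Y i, (d i).comp h = g) ∧
    ∃ ι : N →ₗ[R] Y 0, Function.Injective ι ∧ Function.Exact ι (d 0)

/-- `N` is `G_C`-projective: the cokernel of the degree `0` differential of a complete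
`P_C P`-resolution. -/
def IsGCProjective (C : Type u) [AddCommGroup C] [Module R C]
    (N : Type u) [AddCommGroup N] [Module R N] : Prop :=
  ∃ (X : ℤ → ModuleCat.{u} R) (d : ∀ i : ℤ, X i →ₗ[R] X (i + 1)),
    (∀ i : ℤ, i ≤ 0 → Module.Projective R (X i)) ∧
    (∀ i : ℤ, 0 < i → IsCProjective R C (X i)) ∧
    (∀ i, Function.Exact (d i) (d (i + 1))) ∧
    (∀ (Q : ModuleCat.{u} R), IsCProjective R C Q →
      ∀ (i : ℤ) (g : X (i + 1) →ₗ[R] Q), g.comp (d i) = 0 →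
        ∃ h : X (i + 1 + 1) →ₗ[R] Q, h.comp (d (i + 1)) = g) ∧
    ∃ π : X 0 →ₗ[R] N, Function.Surjective π ∧ Function.Exact (d (-1)) π

/-- `N` is `G_C`-flat: the cokernel of the degree `0` differential of a complete
`F_C F`-resolution. -/
def IsGCFlat (C : Type u) [AddCommGroup C] [Module R C]
    (N : Type u) [AddCommGroup N] [Module R N] : Prop :=
  ∃ (Z : ℤ → ModuleCat.{u} R) (d : ∀ i : ℤ, Z i →ₗ[R] Z (i + 1)),
    (∀ i : ℤ, i ≤ 0 → Module.Flat R (Z i)) ∧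
    (∀ i : ℤ, 0 < i → IsCFlat R C (Z i)) ∧
    (∀ i, Function.Exact (d i) (d (i + 1))) ∧
    (∀ (J : ModuleCat.{u} R), IsCInjective R C J →
      ∀ i : ℤ, Function.Exact (LinearMap.rTensor (R := R) J (d i))
        (LinearMap.rTensor (R := R) J (d (i + 1)))) ∧
    ∃ π : Z 0 →ₗ[R] N, Function.Surjective π ∧ Function.Exact (d (-1)) π

/-- `G_C`-injective dimension `Gid_C M`. -/
noncomputable def GCinjDim (C : Type u) [AddCommGroup C] [Module R C]
    (M : Type u) [AddCommGroup M] [Module R M] : ℕ∞ :=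
  CoresDim R (fun N => IsGCInjective R C N) (ModuleCat.of R M)

/-- `G_C`-projective dimension `G_C-pd_R M`. -/
noncomputable def GCprojDim (C : Type u) [AddCommGroup C] [Module R C]
    (M : Type u) [AddCommGroup M] [Module R M] : ℕ∞ :=
  ResDim R (fun N => IsGCProjective R C N) (ModuleCat.of R M)

/-- `G_C`-flat dimension `G_C-fd_R M`. -/
noncomputable def GCflatDim (C : Type u) [AddCommGroup C] [Module R C]
    (M : Type u) [AddCommGroup M] [Module R M] : ℕ∞ :=
  ResDim R (fun N => IsGCFlat R C N) (ModuleCat.of R M)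

end Paper

namespace GH

section inj
variable {R : Type u} [CommRing R]

theorem ext_of_ker_le {A B X : Type u} [AddCommGroup A] [Module R A] [AddCommGroup B] [Module R B]
    [AddCommGroup X] [Module R X] (hX : Module.Injective R X) (q : A →ₗ[R] B) (g : A →ₗ[R] X)
    (h : LinearMap.ker q ≤ LinearMap.ker g) : ∃ h : B →ₗ[R] X, h.comp q = g := by
  have hi : Function.Injective ((LinearMap.ker q).liftQ q le_rfl) := by
    rw [← LinearMap.ker_eq_bot]
    exact Submodule.ker_liftQ_eq_bot _ _ _ le_rfl
  obtain ⟨k, hk⟩ := hX.out ((LinearMap.ker q).liftQ q le_rfl) hi ((LinearMap.ker q).liftQ g h)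
  refine ⟨k, ?_⟩
  ext a
  have := hk (Submodule.Quotient.mk a)
  simpa using this

theorem inj_of_retract {X Y : Type u} [AddCommGroup X] [Module R X] [AddCommGroup Y] [Module R Y]
    (hX : Module.Injective R X) (i : Y →ₗ[R] X) (p : X →ₗ[R] Y) (h : p.comp i = LinearMap.id) :
    Module.Injective R Y := by
  refine ⟨fun A B _ _ _ _ f hf g => ?_⟩
  obtain ⟨k, hk⟩ := hX.out f hf (i.comp g)
  refine ⟨p.comp k, fun x => ?_⟩
  rw [LinearMap.comp_apply, hk]
  exact LinearMap.congr_fun h (g x)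

theorem inj_of_equiv {X Y : Type u} [AddCommGroup X] [Module R X] [AddCommGroup Y] [Module R Y]
    (hX : Module.Injective R X) (e : X ≃ₗ[R] Y) : Module.Injective R Y :=
  inj_of_retract hX e.symm.toLinearMap e.toLinearMap (by ext; simp)

theorem inj_quot {A X Q : Type u} [AddCommGroup A] [Module R A] [AddCommGroup X] [Module R X]
    [AddCommGroup Q] [Module R Q]
    (hA : Module.Injective R A) (hX : Module.Injective R X) (i : A →ₗ[R] X) (p : X →ₗ[R] Q)
    (hi : Function.Injective i) (hip : Function.Exact i p)
    (hp : Function.Surjective p) : Module.Injective R Q := by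
  obtain ⟨r, hr⟩ := hA.out i hi LinearMap.id
  obtain ⟨s, hs⟩ := ext_of_ker_le hX p (LinearMap.id - i.comp r) (by
    intro x hx
    obtain ⟨a, rfl⟩ := (hip x).1 hx
    simp [hr])
  refine inj_of_retract hX s p ?_
  ext y
  obtain ⟨x, rfl⟩ := hp y
  have h1 := LinearMap.congr_fun hs x
  simp only [LinearMap.comp_apply, LinearMap.sub_apply, LinearMap.id_apply] at h1 ⊢
  rw [h1, map_sub, hip.apply_apply_eq_zero, sub_zero]

theorem almost_div [IsNoetherianRing R] {X : Type u} [AddCommGroup X] [Module R X]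
    (hX : Module.Injective R X) (x : R) (b : X) (n : ℕ) :
    ∃ (e : X) (k : ℕ), x ^ (n + k) • e = x ^ k • b := by
  obtain ⟨k, hk⟩ := monotone_stabilizes_iff_noetherian.2 (inferInstanceAs (IsNoetherian R R))
    ⟨fun k => LinearMap.ker (LinearMap.mulLeft R (x ^ k)), by
      intro i j hij a ha
      obtain ⟨c, rfl⟩ := Nat.exists_eq_add_of_le hij
      simp only [LinearMap.mem_ker, LinearMap.mulLeft_apply] at ha ⊢
      rw [pow_add, mul_assoc, mul_comm (x^c), ← mul_assoc, ha, zero_mul]⟩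
  obtain ⟨h, hh⟩ := ext_of_ker_le hX (LinearMap.mulLeft R (x ^ (n + k)))
    (LinearMap.toSpanSingleton R X (x ^ k • b)) (by
      intro r hr
      have h2 := hk (n + k) (by omega)
      have hr' : r ∈ LinearMap.ker (LinearMap.mulLeft R (x ^ k)) := by
        rw [show LinearMap.ker (LinearMap.mulLeft R (x ^ k)) =
          LinearMap.ker (LinearMap.mulLeft R (x ^ (n + k))) from h2]
        exact hr
      simp only [LinearMap.mem_ker, LinearMap.mulLeft_apply, LinearMap.toSpanSingleton_apply] at hr' ⊢
      rw [smul_smul, mul_comm, hr', zero_smul])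
  refine ⟨h 1, k, ?_⟩
  have := LinearMap.congr_fun hh 1
  simp only [LinearMap.comp_apply, LinearMap.mulLeft_apply, LinearMap.toSpanSingleton_apply,
    one_smul, mul_one] at this
  rw [← this, ← map_smul, smul_eq_mul, mul_one]

/-- The `a`-torsion submodule. -/
def torsI (a : Ideal R) (X : Type u) [AddCommGroup X] [Module R X] : Submodule R X where
  carrier := {v | ∃ k : ℕ, ∀ r ∈ a ^ k, r • v = 0}
  zero_mem' := ⟨0, by simp⟩
  add_mem' := by
    rintro v w ⟨k, hk⟩ ⟨l, hl⟩
    refine ⟨k + l, fun r hr => ?_⟩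
    rw [smul_add, hk r (Ideal.pow_le_pow_right (by omega) hr),
      hl r (Ideal.pow_le_pow_right (by omega) hr), add_zero]
  smul_mem' := by
    rintro c v ⟨k, hk⟩
    refine ⟨k, fun r hr => ?_⟩
    rw [smul_comm, hk r hr, smul_zero]

theorem mem_torsI {a : Ideal R} {X : Type u} [AddCommGroup X] [Module R X] {v : X} :
    v ∈ torsI a X ↔ ∃ k : ℕ, ∀ r ∈ a ^ k, r • v = 0 := Iff.rfl

theorem map_torsI (a : Ideal R) {X Y : Type u} [AddCommGroup X] [Module R X]
    [AddCommGroup Y] [Module R Y] (f : X →ₗ[R] Y) {v : X} (hv : v ∈ torsI a X) :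
    f v ∈ torsI a Y := by
  obtain ⟨k, hk⟩ := hv
  exact ⟨k, fun r hr => by rw [← map_smul, hk r hr, map_zero]⟩

/-- functoriality of torsion -/
def torsMap (a : Ideal R) {X Y : Type u} [AddCommGroup X] [Module R X]
    [AddCommGroup Y] [Module R Y] (f : X →ₗ[R] Y) : torsI a X →ₗ[R] torsI a Y :=
  f.restrict (fun _ hv => map_torsI a f hv)

@[simp] theorem torsMap_coe (a : Ideal R) {X Y : Type u} [AddCommGroup X] [Module R X]
    [AddCommGroup Y] [Module R Y] (f : X →ₗ[R] Y) (v : torsI a X) :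
    (torsMap a f v : Y) = f v := rfl

theorem tors_unif (a : Ideal R) {X : Type u} [AddCommGroup X] [Module R X]
    {M : Type u} [AddCommGroup M] [Module R M] [hM : Module.Finite R M]
    (g : M →ₗ[R] torsI a X) : ∃ k : ℕ, ∀ r ∈ a ^ k, ∀ m, r • g m = 0 := by
  obtain ⟨s, hs⟩ := hM.fg_top
  have : ∀ m : M, ∃ k : ℕ, ∀ r ∈ a ^ k, r • g m = 0 := fun m => by
    obtain ⟨k, hk⟩ := (g m).2
    exact ⟨k, fun r hr => Subtype.ext (hk r hr)⟩
  choose k hk using this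
  refine ⟨s.sup k, fun r hr m => ?_⟩
  have hm : m ∈ Submodule.span R (s : Set M) := by rw [hs]; trivial
  induction hm using Submodule.span_induction with
  | mem x h => exact hk x r (Ideal.pow_le_pow_right (Finset.le_sup h) hr)
  | zero => simp
  | add x y _ _ hx hy => rw [map_add, smul_add, hx, hy, add_zero]
  | smul c x _ hx => rw [map_smul, smul_comm, hx, smul_zero]

theorem tors_inj [IsNoetherianRing R] (a : Ideal R) {X : Type u} [AddCommGroup X] [Module R X]
    (hX : Module.Injective R X) : Module.Injective R (torsI a X) := by
  refine Module.Baer.injective ?_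
  intro I g
  obtain ⟨k, hk⟩ := tors_unif a g
  obtain ⟨c, hc⟩ := Ideal.exists_pow_inf_eq_pow_smul a (I.restrictScalars R : Submodule R R)
  have hc' := hc (k + c) (by omega)
  obtain ⟨h, hh⟩ := ext_of_ker_le hX ((Submodule.mkQ (a ^ (k + c))).comp I.subtype)
    ((torsI a X).subtype.comp g) (by
      intro y hy
      have h1 : (y : R) ∈ a ^ (k + c) := (Submodule.Quotient.mk_eq_zero _).1 hy
      have h2 : (y : R) ∈ (a ^ (k + c) • ⊤ ⊓ I : Submodule R R) := ⟨by simpa using h1, y.2⟩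
      have h3 : (y : R) ∈ a ^ (k + c - c) • (a ^ c • ⊤ ⊓ I : Submodule R R) := hc' ▸ h2
      rw [Nat.add_sub_cancel] at h3
      have h4 : (y : R) ∈ a ^ k • I := Submodule.smul_mono le_rfl inf_le_right h3
      have h5 : ∀ z : R, z ∈ a ^ k • I → ∃ hz : z ∈ I, g ⟨z, hz⟩ = 0 := by
        intro z hz
        refine Submodule.smul_induction_on hz ?_ ?_
        · intro r hr n hn
          refine ⟨I.mul_mem_left r hn, ?_⟩
          have := hk r hr ⟨n, hn⟩
          rwa [← map_smul] at this
        · rintro x y ⟨hx, hx'⟩ ⟨hy, hy'⟩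
          refine ⟨I.add_mem hx hy, ?_⟩
          have := map_add g ⟨x, hx⟩ ⟨y, hy⟩
          rw [hx', hy', add_zero] at this
          exact this
      obtain ⟨_, h6⟩ := h5 y h4
      simpa using h6)
  refine ⟨LinearMap.toSpanSingleton R _ ⟨h (Submodule.Quotient.mk 1), k + c, fun r hr => ?_⟩, ?_⟩
  · rw [← map_smul, ← Submodule.Quotient.mk_smul, smul_eq_mul, mul_one,
      (Submodule.Quotient.mk_eq_zero _).2 hr, map_zero]
  · intro y hy
    have := LinearMap.congr_fun hh ⟨y, hy⟩
    apply Subtype.ext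
    simp only [LinearMap.comp_apply, Submodule.subtype_apply, Submodule.mkQ_apply] at this
    rw [← this, LinearMap.toSpanSingleton_apply, Submodule.coe_smul, ← map_smul,
      ← Submodule.Quotient.mk_smul, smul_eq_mul, mul_one]

theorem dsum_inj [IsNoetherianRing R] (E : ℕ → Type u) [∀ i, AddCommGroup (E i)]
    [∀ i, Module R (E i)] (hE : ∀ i, Module.Injective R (E i)) :
    Module.Injective R (DirectSum ℕ E) := by
  classical
  refine Module.Baer.injective ?_
  intro I g
  obtain ⟨s, hs⟩ := (inferInstance : Module.Finite R I).fg_top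
  have h1 : ∃ S : Finset ℕ, ∀ y : I, ∀ i ∉ S, g y i = 0 := by
    refine ⟨s.biUnion fun y => DFinsupp.support (g y), fun y i hi => ?_⟩
    have hm : y ∈ Submodule.span R (s : Set I) := by rw [hs]; trivial
    induction hm using Submodule.span_induction with
    | mem x h =>
      by_contra hne
      exact hi (Finset.mem_biUnion.2 ⟨x, h, DFinsupp.mem_support_iff.2 hne⟩)
    | zero => simp
    | add x y _ _ hx hy => rw [map_add, DirectSum.add_apply, hx, hy, add_zero]
    | smul c x _ hx => rw [map_smul, DirectSum.smul_apply, hx, smul_zero]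
  obtain ⟨S, hS⟩ := h1
  have h2 : ∀ i, ∃ e : E i, ∀ y : I, (y : R) • e = g y i := by
    intro i
    obtain ⟨h, hh⟩ := ext_of_ker_le (hE i) I.subtype ((DirectSum.component R ℕ E i).comp g)
      (by rw [Submodule.ker_subtype]; exact bot_le)
    refine ⟨h 1, fun y => ?_⟩
    have := LinearMap.congr_fun hh y
    simp only [LinearMap.comp_apply, Submodule.subtype_apply] at this
    rw [← map_smul, smul_eq_mul, mul_one, this]; rfl
  choose e he using h2
  refine ⟨LinearMap.toSpanSingleton R _ (DFinsupp.mk S fun i => e i), ?_⟩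
  intro y hy
  apply DFinsupp.ext
  intro i
  rw [LinearMap.toSpanSingleton_apply]
  change y • (DFinsupp.mk S fun i => e i) i = _
  rw [DFinsupp.mk_apply]
  split_ifs with h
  · exact he i ⟨y, hy⟩
  · rw [smul_zero]; exact (hS _ i h).symm

end inj
end GH

namespace GH

theorem exists_dep_seq {α : ℕ → Type*} (P : ∀ i, α i → Prop) (Q : ∀ i, α i → α (i + 1) → Prop)
    (a0 : α 0) (h0 : P 0 a0) (step : ∀ i a, P i a → ∃ b, P (i + 1) b ∧ Q i a b) :
    ∃ s : ∀ i, α i, s 0 = a0 ∧ (∀ i, P i (s i)) ∧ ∀ i, Q i (s i) (s (i + 1)) := by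
  choose nx hnx1 hnx2 using step
  let t : ∀ i, {a : α i // P i a} := fun i => Nat.rec (motive := fun i => {a : α i // P i a})
    ⟨a0, h0⟩ (fun i a => ⟨nx i a.1 a.2, hnx1 i a.1 a.2⟩) i
  exact ⟨fun i => (t i).1, rfl, fun i => (t i).2, fun i => hnx2 i _ _⟩

section contr
variable {R : Type u} [CommRing R]

/-- Null-homotopy of all maps to exact differential modules with injective underlying module. -/
def Contr {X : Type u} [AddCommGroup X] [Module R X] (d : X →ₗ[R] X) : Prop :=
  ∀ (Y : ModuleCat.{u} R) (D : Y →ₗ[R] Y), Module.Injective R Y → Function.Exact D D →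
    ∀ f : X →ₗ[R] Y, D.comp f = f.comp d → ∃ s : X →ₗ[R] Y, f = D.comp s + s.comp d

theorem Contr.equiv {X X' : Type u} [AddCommGroup X] [Module R X] [AddCommGroup X'] [Module R X']
    {d : X →ₗ[R] X} {d' : X' →ₗ[R] X'} (h : Contr d) (e : X ≃ₗ[R] X')
    (he : ∀ x, e (d x) = d' (e x)) : Contr d' := by
  intro Y D hY hD f hf
  obtain ⟨s, hs⟩ := h Y D hY hD (f.comp e.toLinearMap) (by
    ext x
    have := LinearMap.congr_fun hf (e x)
    simp only [LinearMap.comp_apply, LinearEquiv.coe_coe] at this ⊢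
    rw [this, he])
  refine ⟨s.comp e.symm.toLinearMap, ?_⟩
  ext x
  obtain ⟨x, rfl⟩ := e.surjective x
  have := LinearMap.congr_fun hs x
  simp only [LinearMap.comp_apply, LinearEquiv.coe_coe, LinearMap.add_apply] at this ⊢
  rw [this, ← he, e.symm_apply_apply, e.symm_apply_apply]

theorem Contr.chase {X' X X'' : Type u} [AddCommGroup X] [Module R X] [AddCommGroup X']
    [Module R X'] [AddCommGroup X''] [Module R X'']
    {d' : X' →ₗ[R] X'} {d : X →ₗ[R] X} {d'' : X'' →ₗ[R] X''}
    (i : X' →ₗ[R] X) (p : X →ₗ[R] X'') (hi : Function.Injective i) (hip : Function.Exact i p)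
    (hp : Function.Surjective p) (hid : ∀ x, i (d' x) = d (i x)) (hpd : ∀ x, p (d x) = d'' (p x))
    (hdd : ∀ x, d (d x) = 0)
    (h : Contr d) (h'' : Contr d'') : Contr d' := by
  intro Y D hY hD f hf
  have hDD : ∀ y, D (D y) = 0 := hD.apply_apply_eq_zero
  obtain ⟨F, hF⟩ := ext_of_ker_le hY i f (by rw [LinearMap.ker_eq_bot.2 hi]; exact bot_le)
  have hF' := LinearMap.congr_fun hF
  have hf' := LinearMap.congr_fun hf
  simp only [LinearMap.comp_apply] at hF' hf'
  obtain ⟨w, hw⟩ := ext_of_ker_le hY p (D.comp F - F.comp d) (by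
    intro x hx
    obtain ⟨x, rfl⟩ := (hip x).1 hx
    simp only [LinearMap.mem_ker, LinearMap.sub_apply, LinearMap.comp_apply]
    rw [← hid, hF', hF', hf', sub_self])
  have hw' := LinearMap.congr_fun hw
  simp only [LinearMap.comp_apply, LinearMap.sub_apply] at hw'
  obtain ⟨v, hv⟩ := h'' Y (-D) hY (by
    intro y
    rw [LinearMap.neg_apply, neg_eq_zero, hD y]
    constructor
    · rintro ⟨z, rfl⟩; exact ⟨-z, by simp⟩
    · rintro ⟨z, rfl⟩; exact ⟨-z, by simp⟩) w (by
    ext x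
    obtain ⟨x, rfl⟩ := hp x
    simp only [LinearMap.comp_apply, LinearMap.neg_apply]
    rw [← hpd, hw', hw', map_sub, hDD, hdd]; simp)
  have hv' := LinearMap.congr_fun hv
  simp only [LinearMap.comp_apply, LinearMap.add_apply, LinearMap.neg_apply] at hv'
  obtain ⟨s, hs⟩ := h Y D hY hD (F + v.comp p) (by
    ext x
    simp only [LinearMap.comp_apply, LinearMap.add_apply, map_add]
    have h1 := hw' x
    rw [hv', ← hpd] at h1
    rw [← sub_eq_zero] at h1 ⊢
    rw [← neg_eq_zero, ← h1]
    abel)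
  have hs' := LinearMap.congr_fun hs
  simp only [LinearMap.comp_apply, LinearMap.add_apply] at hs'
  refine ⟨s.comp i, ?_⟩
  ext x
  simp only [LinearMap.comp_apply, LinearMap.add_apply]
  rw [← hF', hid, ← hs' (i x), hip.apply_apply_eq_zero, map_zero, add_zero]

theorem Contr.finsupp {X : Type u} [AddCommGroup X] [Module R X] {d : X →ₗ[R] X} (h : Contr d) :
    Contr (Finsupp.mapRange.linearMap (α := ℕ) d) := by
  intro Y D hY hD f hf
  have : ∀ n : ℕ, ∃ s : X →ₗ[R] Y, f.comp (Finsupp.lsingle n) = D.comp s + s.comp d := by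
    intro n
    refine h Y D hY hD _ ?_
    ext x
    have := LinearMap.congr_fun hf (Finsupp.single n x)
    simpa using this
  choose s hs using this
  refine ⟨Finsupp.lsum ℕ s, ?_⟩
  ext n x
  have := LinearMap.congr_fun (hs n) x
  simpa using this

/-- the telescope map -/
noncomputable def tele (x : R) (X : Type u) [AddCommGroup X] [Module R X] :
    (ℕ →₀ X) →ₗ[R] (ℕ →₀ X) :=
  Finsupp.lsum ℕ (fun n => match n with
    | 0 => Finsupp.lsingle 0
    | n + 1 => Finsupp.lsingle n - x • Finsupp.lsingle (n + 1))

theorem tele_zero (x : R) {X : Type u} [AddCommGroup X] [Module R X] (e : X) :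
    tele x X (Finsupp.single 0 e) = Finsupp.single 0 e := by
  simp [tele]

theorem tele_succ (x : R) {X : Type u} [AddCommGroup X] [Module R X] (n : ℕ) (e : X) :
    tele x X (Finsupp.single (n + 1) e) = Finsupp.single n e - Finsupp.single (n + 1) (x • e) := by
  simp [tele]

theorem tele_apply_zero (x : R) {X : Type u} [AddCommGroup X] [Module R X] (s : ℕ →₀ X) :
    tele x X s 0 = s 0 + s 1 := by
  induction s using Finsupp.induction_linear with
  | zero => simp
  | add f g hf hg => rw [map_add, Finsupp.add_apply, hf, hg]; simp only [Finsupp.add_apply]; abel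
  | single n e =>
    rcases n with _ | n
    · rw [tele_zero]; simp
    · rw [tele_succ]
      rcases n with _ | n <;> simp

theorem tele_apply_succ (x : R) {X : Type u} [AddCommGroup X] [Module R X] (s : ℕ →₀ X) (m : ℕ) :
    tele x X s (m + 1) = s (m + 2) - x • s (m + 1) := by
  induction s using Finsupp.induction_linear with
  | zero => simp
  | add f g hf hg =>
    rw [map_add (tele x X), Finsupp.add_apply, hf, hg]
    simp only [Finsupp.add_apply, smul_add]; abel
  | single n e =>
    rcases n with _ | n
    · rw [tele_zero]; simp
    · rw [tele_succ]
      simp only [Finsupp.sub_apply, Finsupp.single_apply]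
      split_ifs <;> first | omega | simp_all

theorem tele_surj [IsNoetherianRing R] (x : R) {X : Type u} [AddCommGroup X] [Module R X]
    (hX : Module.Injective R X) : Function.Surjective (tele x X) := by
  have h1 : ∀ k n (b : X), Finsupp.single n b - Finsupp.single (n + k) (x ^ k • b) ∈
      LinearMap.range (tele x X) := by
    intro k
    induction k with
    | zero => intro n b; simp
    | succ k ih =>
      intro n b
      have h2 := ih n b
      have h3 : tele x X (Finsupp.single (n + k + 1) (x ^ k • b)) ∈ LinearMap.range (tele x X) :=
        ⟨_, rfl⟩
      rw [tele_succ] at h3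
      have := add_mem h2 h3
      rw [smul_smul, ← pow_succ'] at this
      simpa [add_assoc] using this
  rw [← LinearMap.range_eq_top, eq_top_iff]
  intro s _
  induction s using Finsupp.induction_linear with
  | zero => exact zero_mem _
  | add f g hf hg => exact add_mem (hf trivial) (hg trivial)
  | single n b =>
    obtain ⟨e, k, he⟩ := almost_div hX x b n
    have h2 := h1 k n b
    rw [← he] at h2
    have h3 := h1 (n + k) 0 e
    rw [zero_add] at h3
    have h4 : Finsupp.single 0 e ∈ LinearMap.range (tele x X) := ⟨_, tele_zero x e⟩
    have := add_mem (sub_mem h2 h3) h4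
    simpa using this

theorem mem_torsI_span {x : R} {X : Type u} [AddCommGroup X] [Module R X] {v : X} :
    v ∈ torsI (Ideal.span {x}) X ↔ ∃ k : ℕ, x ^ k • v = 0 := by
  rw [mem_torsI]
  refine exists_congr fun k => ?_
  rw [Ideal.span_singleton_pow]
  constructor
  · intro h; exact h _ (Ideal.mem_span_singleton_self _)
  · intro h r hr
    obtain ⟨c, rfl⟩ := Ideal.mem_span_singleton'.1 hr
    rw [mul_smul, h, smul_zero]

theorem ker_tele_succ {x : R} {X : Type u} [AddCommGroup X] [Module R X] {s : ℕ →₀ X}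
    (hs : tele x X s = 0) (n : ℕ) : s (n + 1) = - (x ^ n • s 0) := by
  induction n with
  | zero =>
    have := tele_apply_zero x s
    rw [hs] at this
    simp only [Finsupp.zero_apply] at this
    rw [pow_zero, one_smul, ← add_eq_zero_iff_eq_neg', ← this]
  | succ n ih =>
    have := tele_apply_succ x s n
    rw [hs, ih] at this
    simp only [Finsupp.zero_apply] at this
    rw [eq_comm, sub_eq_zero] at this
    rw [this, smul_neg, smul_smul, pow_succ']

theorem Contr.tors_span [IsNoetherianRing R] (x : R) {X : Type u} [AddCommGroup X] [Module R X]
    {d : X →ₗ[R] X} (hX : Module.Injective R X) (hdd : ∀ x, d (d x) = 0) (h : Contr d) :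
    Contr (torsMap (Ideal.span {x}) d) := by
  classical
  have hcomm : ∀ s, tele x X (Finsupp.mapRange.linearMap d s) =
      Finsupp.mapRange.linearMap d (tele x X s) := by
    intro s
    induction s using Finsupp.induction_linear with
    | zero => simp
    | add f g hf hg => simp only [map_add, hf, hg]
    | single n e =>
      rcases n with _ | n
      · simp [tele_zero]
      · rw [tele_succ, map_sub]; simp [tele_succ]
  let d1 : LinearMap.ker (tele x X) →ₗ[R] LinearMap.ker (tele x X) :=
    (Finsupp.mapRange.linearMap d).restrict (fun s hs => by
      rw [LinearMap.mem_ker] at hs ⊢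
      rw [hcomm, hs, map_zero])
  have hk : Contr d1 := by
    refine Contr.chase (d' := d1) (LinearMap.ker (tele x X)).subtype (tele x X)
      Subtype.val_injective ?_ (tele_surj x hX) (fun _ => rfl) hcomm ?_ h.finsupp h.finsupp
    · intro s
      constructor
      · intro hs; exact ⟨⟨s, hs⟩, rfl⟩
      · rintro ⟨s, rfl⟩; exact s.2
    · intro s; ext n; simp [hdd]
  let φ : LinearMap.ker (tele x X) →ₗ[R] torsI (Ideal.span {x}) X :=
    ((Finsupp.lapply 0).comp (LinearMap.ker (tele x X)).subtype).codRestrict _ (by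
      rintro ⟨s, hs⟩
      rw [mem_torsI_span]
      obtain ⟨N, hN⟩ := s.support.exists_nat_subset_range
      refine ⟨N, ?_⟩
      have h1 := ker_tele_succ hs N
      have h2 : s (N + 1) = 0 := by
        by_contra hne
        have := hN (Finsupp.mem_support_iff.2 hne)
        simp at this
      rw [h2, eq_comm, neg_eq_zero] at h1
      exact h1)
  have hφ : Function.Bijective φ := by
    constructor
    · rw [← LinearMap.ker_eq_bot, eq_bot_iff]
      rintro ⟨s, hs⟩ h0
      have h0' : s 0 = 0 := congrArg Subtype.val h0
      apply Subtype.ext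
      ext n
      rcases n with _ | n
      · exact h0'
      · rw [ker_tele_succ hs, h0', smul_zero, neg_zero]; rfl
    · rintro ⟨v, hv⟩
      obtain ⟨k, hk⟩ := mem_torsI_span.1 hv
      let F : ℕ → X := fun n => match n with
        | 0 => v
        | n + 1 => - (x ^ n • v)
      let s : ℕ →₀ X := Finsupp.onFinset (Finset.range (k + 1)) F (by
        intro n hn
        by_contra hlt
        apply hn
        simp only [Finset.mem_range, not_lt] at hlt
        obtain ⟨m, rfl⟩ : ∃ m, n = (m + k) + 1 := ⟨n - 1 - k, by omega⟩
        change - (x ^ (m + k) • v) = 0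
        rw [pow_add, mul_smul, hk, smul_zero, neg_zero])
      have hs0 : s 0 = v := rfl
      have hs1 : ∀ n, s (n + 1) = - (x ^ n • v) := fun n => rfl
      refine ⟨⟨s, ?_⟩, Subtype.ext hs0⟩
      rw [LinearMap.mem_ker]
      ext n
      rcases n with _ | n
      · rw [tele_apply_zero, hs0, hs1]; simp
      · rw [tele_apply_succ, hs1, hs1, pow_succ', mul_smul]; simp
  exact hk.equiv (LinearEquiv.ofBijective φ hφ) (fun s => Subtype.ext rfl)

theorem Contr.tors [IsNoetherianRing R] (a : Ideal R) : ∀ {X : Type u} [AddCommGroup X] [Module R X]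
    {d : X →ₗ[R] X} (_ : Module.Injective R X) (_ : ∀ x, d (d x) = 0) (_ : Contr d),
    Contr (torsMap a d) := by
  refine Submodule.fg_induction (R := R) (M := R) (motive := fun (a : Ideal R) _ => ∀ {X : Type u} [AddCommGroup X] [Module R X]
    {d : X →ₗ[R] X} (_ : Module.Injective R X) (_ : ∀ x, d (d x) = 0) (_ : Contr d),
    Contr (torsMap a d)) ?_ ?_ a (IsNoetherian.noetherian a)
  · intro x X _ _ d h1 h2 h3
    exact h3.tors_span x h1 h2
  · intro a b _ _ ha hb X _ _ d h1 h2 h3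
    have h4 : Contr (torsMap a (torsMap b d)) :=
      ha (tors_inj b h1) (fun v => Subtype.ext (h2 _)) (hb h1 h2 h3)
    let e : torsI a (torsI b X) →ₗ[R] torsI (a ⊔ b) X :=
      ((torsI b X).subtype.comp (torsI a (torsI b X)).subtype).codRestrict _ (by
        rintro ⟨⟨v, l, hl⟩, k, hk⟩
        refine ⟨k + l, fun r hr => ?_⟩
        obtain ⟨p, hp, q, hq, rfl⟩ := Submodule.mem_sup.1 (Ideal.sup_pow_add_le_pow_sup_pow hr)
        have h5 : p • v = 0 := congrArg Subtype.val (hk p hp)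
        have h6 := hl q hq
        change (p + q) • v = 0
        rw [add_smul, h5, h6, add_zero])
    refine h4.equiv (LinearEquiv.ofBijective e ⟨?_, ?_⟩) (fun _ => Subtype.ext rfl)
    · intro v w hvw
      have h5 : ((v : torsI b X) : X) = ((w : torsI b X) : X) :=
        congrArg (fun z : torsI (a ⊔ b) X => (z : X)) hvw
      exact Subtype.ext (Subtype.ext h5)
    · rintro ⟨v, k, hk⟩
      exact ⟨⟨⟨v, k, fun r hr => hk r (Ideal.pow_right_mono le_sup_right k hr)⟩, k, fun r hr =>
        Subtype.ext (hk r (Ideal.pow_right_mono le_sup_left k hr))⟩, rfl⟩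

/-- total differential -/
noncomputable def totd (E : ℕ → Type u) [∀ i, AddCommGroup (E i)] [∀ i, Module R (E i)]
    (d : ∀ i, E i →ₗ[R] E (i + 1)) : DirectSum ℕ E →ₗ[R] DirectSum ℕ E :=
  DirectSum.toModule R ℕ _ (fun i => (DirectSum.lof R ℕ E (i + 1)).comp (d i))

theorem totd_lof (E : ℕ → Type u) [∀ i, AddCommGroup (E i)] [∀ i, Module R (E i)]
    (d : ∀ i, E i →ₗ[R] E (i + 1)) (i : ℕ) (x : E i) :
    totd E d (DirectSum.lof R ℕ E i x) = DirectSum.lof R ℕ E (i + 1) (d i x) := by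
  simp [totd]

theorem totd_totd (E : ℕ → Type u) [∀ i, AddCommGroup (E i)] [∀ i, Module R (E i)]
    (d : ∀ i, E i →ₗ[R] E (i + 1)) (hd : ∀ i x, d (i + 1) (d i x) = 0) (x : DirectSum ℕ E) :
    totd E d (totd E d x) = 0 := by
  have : (totd E d).comp (totd E d) = 0 := by
    refine DirectSum.linearMap_ext R fun i => ?_
    ext x : 1
    simp only [LinearMap.comp_apply, totd_lof, hd, map_zero, LinearMap.zero_apply]
  exact LinearMap.congr_fun this x

theorem Contr.base (E : ℕ → Type u) [∀ i, AddCommGroup (E i)] [∀ i, Module R (E i)]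
    (d : ∀ i, E i →ₗ[R] E (i + 1)) (ε : R →ₗ[R] E 0) (hε : Function.Injective ε)
    (hε0 : Function.Exact ε (d 0)) (hd : ∀ i, Function.Exact (d i) (d (i + 1))) :
    Contr (totd E d) := by
  intro Y D hY hD f hf
  have hDD : ∀ y, D (D y) = 0 := hD.apply_apply_eq_zero
  let fi : ∀ i, E i →ₗ[R] Y := fun i => f.comp (DirectSum.lof R ℕ E i)
  have hfi : ∀ i x, D (fi i x) = fi (i + 1) (d i x) := by
    intro i x
    have := LinearMap.congr_fun hf (DirectSum.lof R ℕ E i x)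
    simp only [LinearMap.comp_apply, totd_lof] at this
    exact this
  obtain ⟨z, hz⟩ := (hD (fi 0 (ε 1))).1 (by rw [hfi, hε0.apply_apply_eq_zero, map_zero])
  obtain ⟨s0, hs0⟩ := ext_of_ker_le hY ε (LinearMap.toSpanSingleton R Y z)
    (by rw [LinearMap.ker_eq_bot.2 hε]; exact bot_le)
  obtain ⟨s, -, -, hs⟩ := exists_dep_seq (α := fun i => E i →ₗ[R] Y)
    (fun i s => ∀ x, d i x = 0 → fi i x - D (s x) = 0)
    (fun i s t => ∀ x, fi i x = D (s x) + t (d i x)) s0 (by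
      intro x hx
      obtain ⟨r, rfl⟩ := (hε0 x).1 hx
      have h1 := LinearMap.congr_fun hs0 r
      simp only [LinearMap.comp_apply, LinearMap.toSpanSingleton_apply] at h1
      rw [h1, map_smul, hz, ← map_smul, ← map_smul, smul_eq_mul, mul_one, sub_self]) (by
      intro i s hs
      obtain ⟨t, ht⟩ := ext_of_ker_le hY (d i) (fi i - D.comp s) (fun x hx => hs x hx)
      have ht' := LinearMap.congr_fun ht
      simp only [LinearMap.comp_apply, LinearMap.sub_apply] at ht'
      refine ⟨t, ?_, ?_⟩
      · intro x hx
        obtain ⟨y, rfl⟩ := (hd i x).1 hx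
        rw [ht', map_sub, hDD, sub_zero, hfi, sub_self]
      · intro x; rw [ht']; abel)
  refine ⟨DirectSum.toModule R ℕ Y s, ?_⟩
  refine DirectSum.linearMap_ext R fun i => ?_
  ext x
  have := hs i x
  simp only [LinearMap.comp_apply, LinearMap.add_apply, totd_lof, DirectSum.toModule_lof]
  exact this

end contr
end GH

namespace GH

section ses
variable {R : Type u} [CommRing R]

/-- short exact sequences -/
structure SES {A B C : Type u} [AddCommGroup A] [Module R A] [AddCommGroup B] [Module R B]
    [AddCommGroup C] [Module R C] (f : A →ₗ[R] B) (g : B →ₗ[R] C) : Prop where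
  inj : Function.Injective f
  exact : Function.Exact f g
  surj : Function.Surjective g

variable {A B C : Type u} [AddCommGroup A] [Module R A] [AddCommGroup B] [Module R B]
    [AddCommGroup C] [Module R C] {f : A →ₗ[R] B} {g : B →ₗ[R] C}

/-- the short complex -/
noncomputable abbrev SES.cplx (h : SES f g) : ShortComplex (ModuleCat.{u} R) :=
  ModuleCat.shortComplexOfCompEqZero f g h.exact.linearMap_comp_eq_zero

theorem SES.short (h : SES f g) : h.cplx.ShortExact :=
  ModuleCat.shortComplex_shortExact _ h.exact h.inj h.surj

/-- finite injective dimension -/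
def FID (R : Type u) [CommRing R] (M : Type u) [AddCommGroup M] [Module R M] : Prop :=
  ∃ n, HasInjectiveDimensionLT (ModuleCat.of R M) n

theorem FID.of_inj (h : Module.Injective R A) : FID R A :=
  ⟨1, injective_iff_hasInjectiveDimensionLT_one.1
    ((Module.injective_iff_injective_object R A).1 h)⟩

theorem FID.equiv (h : FID R A) (e : A ≃ₗ[R] B) : FID R B := by
  obtain ⟨n, hn⟩ := h
  exact ⟨n, hasInjectiveDimensionLT_of_iso e.toModuleIso n⟩

theorem SES.fid₁ (h : SES f g) (hB : FID R B) (hC : FID R C) : FID R A := by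
  obtain ⟨m, hm⟩ := hB
  obtain ⟨n, hn⟩ := hC
  exact ⟨m + n + 1, h.short.hasInjectiveDimensionLT_X₁ (m + n)
    (hasInjectiveDimensionLT_of_ge _ n _ (by omega))
    (hasInjectiveDimensionLT_of_ge _ m _ (by omega))⟩

theorem SES.fid₂ (h : SES f g) (hA : FID R A) (hC : FID R C) : FID R B := by
  obtain ⟨m, hm⟩ := hA
  obtain ⟨n, hn⟩ := hC
  exact ⟨m + n, h.short.hasInjectiveDimensionLT_X₂ (m + n)
    (hasInjectiveDimensionLT_of_ge _ m _ (by omega))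
    (hasInjectiveDimensionLT_of_ge _ n _ (by omega))⟩

theorem SES.fid₃ (h : SES f g) (hA : FID R A) (hB : FID R B) : FID R C := by
  obtain ⟨m, hm⟩ := hA
  obtain ⟨n, hn⟩ := hB
  exact ⟨m + n, h.short.hasInjectiveDimensionLT_X₃ (m + n)
    (hasInjectiveDimensionLT_of_ge _ n _ (by omega))
    (hasInjectiveDimensionLT_of_ge _ m _ (by omega))⟩

/-- vanishing of Ext¹ -/
def Ext1 (R : Type u) [CommRing R] (J M : Type u) [AddCommGroup J] [Module R J] [AddCommGroup M]
    [Module R M] : Prop :=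
  Subsingleton (Abelian.Ext (ModuleCat.of R J) (ModuleCat.of R M) 1)

theorem SES.lift {J : Type u} [AddCommGroup J] [Module R J] (h : SES f g) (hJ : Ext1 R J A)
    (φ : J →ₗ[R] C) : ∃ ψ : J →ₗ[R] B, g.comp ψ = φ := by
  have : Subsingleton (Abelian.Ext (ModuleCat.of R J) h.cplx.X₁ 1) := hJ
  obtain ⟨x, hx⟩ := Abelian.Ext.covariant_sequence_exact₃ (ModuleCat.of R J) h.short
    (Abelian.Ext.mk₀ (ModuleCat.ofHom φ)) (zero_add 1) (Subsingleton.elim _ _)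
  obtain ⟨ψ, rfl⟩ := (Abelian.Ext.mk₀_bijective _ _).2 x
  rw [Abelian.Ext.mk₀_comp_mk₀] at hx
  have := (Abelian.Ext.mk₀_bijective _ _).1 hx
  exact ⟨ψ.hom, congrArg ModuleCat.Hom.hom this⟩

theorem SES.ext1_of_lift {J : Type u} [AddCommGroup J] [Module R J] (h : SES f g)
    (hJ : Ext1 R J B) (hl : ∀ φ : J →ₗ[R] C, ∃ ψ : J →ₗ[R] B, g.comp ψ = φ) : Ext1 R J A := by
  have : Subsingleton (Abelian.Ext (ModuleCat.of R J) h.cplx.X₂ 1) := hJ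
  refine subsingleton_of_forall_eq 0 fun x => ?_
  obtain ⟨y, hy⟩ := Abelian.Ext.covariant_sequence_exact₁ (ModuleCat.of R J) h.short x
    (Subsingleton.elim _ _) (zero_add 1)
  obtain ⟨φ, rfl⟩ := (Abelian.Ext.mk₀_bijective _ _).2 y
  obtain ⟨ψ, hψ⟩ := hl φ.hom
  have : φ = ModuleCat.ofHom ψ ≫ h.cplx.g := ModuleCat.hom_ext hψ.symm
  rw [this, ← Abelian.Ext.mk₀_comp_mk₀, Abelian.Ext.comp_assoc (a₂₃ := 1) _ _ _ _ (by simp) (by simp),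
    h.short.comp_extClass, Abelian.Ext.comp_zero] at hy
  exact hy.symm

theorem SES.ext1₂ {J : Type u} [AddCommGroup J] [Module R J] (h : SES f g)
    (hA : Ext1 R J A) (hC : Ext1 R J C) : Ext1 R J B := by
  have : Subsingleton (Abelian.Ext (ModuleCat.of R J) h.cplx.X₁ 1) := hA
  have : Subsingleton (Abelian.Ext (ModuleCat.of R J) h.cplx.X₃ 1) := hC
  refine subsingleton_of_forall_eq 0 fun x => ?_
  obtain ⟨y, hy⟩ := Abelian.Ext.covariant_sequence_exact₂ (ModuleCat.of R J) h.short x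
    (Subsingleton.elim _ _)
  rw [Subsingleton.elim y 0, Abelian.Ext.zero_comp] at hy
  exact hy.symm

theorem Ext1.of_inj {J : Type u} [AddCommGroup J] [Module R J] (h : Module.Injective R A) :
    Ext1 R J A := by
  have := (Module.injective_iff_injective_object R A).1 h
  exact subsingleton_of_forall_eq 0 fun x => Abelian.Ext.eq_zero_of_injective x

/-- one step in the coinductive description of Gorenstein injectives -/
def GIstep (S : ModuleCat.{u} R → Prop) (M : ModuleCat.{u} R) : Prop :=
  (∀ J : ModuleCat.{u} R, Module.Injective R J → Ext1 R J M) ∧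
  ∃ (K I : ModuleCat.{u} R) (j : K →ₗ[R] I) (f : I →ₗ[R] M), Module.Injective R I ∧ SES j f ∧ S K

/-- coinductive class containing the Gorenstein injectives -/
def GIcl (N : ModuleCat.{u} R) : Prop :=
  ∃ S : ModuleCat.{u} R → Prop, S N ∧ ∀ M, S M → GIstep S M

theorem GIcl.step {N : ModuleCat.{u} R} (h : GIcl N) : GIstep GIcl N := by
  obtain ⟨S, hN, hS⟩ := h
  obtain ⟨h1, K, I, j, f, hI, hs, hK⟩ := hS N hN
  exact ⟨h1, K, I, j, f, hI, hs, S, hK, hS⟩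

theorem GIcl.ext {A P B : ModuleCat.{u} R} (hA : GIcl A) (hB : GIcl B) (i : A →ₗ[R] P)
    (p : P →ₗ[R] B) (h : SES i p) : GIcl P := by
  refine ⟨fun P => ∃ (A B : ModuleCat.{u} R) (i : A →ₗ[R] P)
    (p : P →ₗ[R] B), SES i p ∧ GIcl A ∧ GIcl B, ⟨A, B, i, p, h, hA, hB⟩, ?_⟩
  clear hA hB h p i A B P
  rintro P ⟨A, B, i, p, h, hA, hB⟩
  obtain ⟨hA1, KA, IA, jA, fA, hIA, hsA, hKA⟩ := hA.step
  obtain ⟨hB1, KB, IB, jB, fB, hIB, hsB, hKB⟩ := hB.step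
  refine ⟨fun J hJ => h.ext1₂ (hA1 J hJ) (hB1 J hJ), ?_⟩
  obtain ⟨g, hg⟩ := h.lift (hA1 IB hIB) fB
  have hg' : ∀ x, p (g x) = fB x := LinearMap.congr_fun hg
  let F : (IA × IB) →ₗ[R] P := (i.comp fA).coprod g
  have hF : ∀ a b, F (a, b) = i (fA a) + g b := fun a b => by simp [F]
  have hpF : ∀ a b, p (F (a, b)) = fB b := fun a b => by
    rw [hF, map_add, h.exact.apply_apply_eq_zero, hg', zero_add]
  have hk : ∀ z : LinearMap.ker F, ∃ b, jB b = z.1.2 := by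
    rintro ⟨⟨a, b⟩, hz⟩
    refine (hsB.exact b).1 ?_
    rw [← hpF a b, LinearMap.mem_ker.1 hz, map_zero]
  have hjB : LinearMap.ker jB = ⊥ := LinearMap.ker_eq_bot.2 hsB.inj
  let q0 : LinearMap.ker F →ₗ[R] LinearMap.range jB :=
    ((LinearMap.snd R IA IB).comp (LinearMap.ker F).subtype).codRestrict _ hk
  let q : LinearMap.ker F →ₗ[R] KB := (LinearEquiv.ofInjective jB hsB.inj).symm.toLinearMap.comp q0
  have hq : ∀ z, jB (q z) = z.1.2 := fun z =>
    congrArg Subtype.val ((LinearEquiv.ofInjective jB hsB.inj).apply_symm_apply (q0 z))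
  refine ⟨ModuleCat.of R (LinearMap.ker F), ModuleCat.of R (IA × IB), (LinearMap.ker F).subtype, F,
    ?_, ⟨Subtype.val_injective, ?_, ?_⟩, KA, KB,
    ((LinearMap.inl R IA IB).comp jA).codRestrict _ ?_, q, ⟨?_, ?_, ?_⟩, hKA, hKB⟩
  · refine ⟨fun X Y _ _ _ _ m hm e => ?_⟩
    obtain ⟨e1, h1⟩ := hIA.out m hm ((LinearMap.fst R IA IB).comp e)
    obtain ⟨e2, h2⟩ := hIB.out m hm ((LinearMap.snd R IA IB).comp e)
    exact ⟨e1.prod e2, fun x => Prod.ext (h1 x) (h2 x)⟩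
  · intro z
    constructor
    · intro hz; exact ⟨⟨z, hz⟩, rfl⟩
    · rintro ⟨z, rfl⟩; exact z.2
  · intro x
    obtain ⟨b, hb⟩ := hsB.surj (p x)
    obtain ⟨a', ha'⟩ := (h.exact (x - g b)).1 (by rw [map_sub, hg', hb, sub_self])
    obtain ⟨a, rfl⟩ := hsA.surj a'
    exact ⟨(a, b), by rw [hF, ha']; abel⟩
  · intro x
    change F (jA x, 0) = 0
    rw [hF, hsA.exact.apply_apply_eq_zero]; simp
  · intro x y hxy
    have : ((jA x, (0 : IB)) : IA × IB) = (jA y, 0) := congrArg Subtype.val hxy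
    exact hsA.inj (congrArg Prod.fst this)
  · intro z
    constructor
    · intro hz
      have h2 : z.1.2 = 0 := by rw [← hq, hz, map_zero]
      have h3 : F (z.1.1, z.1.2) = 0 := z.2
      rw [hF, h2, map_zero, add_zero, map_eq_zero_iff i h.inj] at h3
      obtain ⟨x, hx⟩ := (hsA.exact _).1 h3
      exact ⟨x, Subtype.ext (Prod.ext hx h2.symm)⟩
    · rintro ⟨x, rfl⟩
      apply hsB.inj
      exact (hq _).trans (map_zero jB).symm
  · intro b
    have h1 : p (g (jB b)) = 0 := by rw [hg', hsB.exact.apply_apply_eq_zero]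
    obtain ⟨a', ha'⟩ := (h.exact _).1 h1
    obtain ⟨a, rfl⟩ := hsA.surj a'
    refine ⟨⟨(-a, jB b), ?_⟩, ?_⟩
    · rw [LinearMap.mem_ker, hF, map_neg, map_neg, ha']; simp
    · exact hsB.inj (hq _)

theorem factor_range {A B C : Type u} [AddCommGroup A] [Module R A] [AddCommGroup B] [Module R B]
    [AddCommGroup C] [Module R C] (ι : A →ₗ[R] B) (hι : Function.Injective ι) (d : C →ₗ[R] B)
    (h : ∀ c, ∃ a, ι a = d c) : ∃ q : C →ₗ[R] A, ∀ c, ι (q c) = d c := by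
  let q0 : C →ₗ[R] LinearMap.range ι := d.codRestrict _ h
  exact ⟨(LinearEquiv.ofInjective ι hι).symm.toLinearMap.comp q0, fun z =>
    congrArg Subtype.val ((LinearEquiv.ofInjective ι hι).apply_symm_apply (q0 z))⟩

theorem GIcl.of_gi {N : ModuleCat.{u} R} (h : Paper.IsGorensteinInjective R N) : GIcl N := by
  obtain ⟨Y, d, hY, hd, hl, ι, hι, hι0⟩ := h
  refine ⟨fun M => ∃ (i : ℤ) (ι : M →ₗ[R] Y i), Function.Injective ι ∧ Function.Exact ι (d i),
    ⟨0, ι, hι, hι0⟩, ?_⟩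
  clear hι hι0 ι N
  rintro M ⟨i, ι, hι, hι0⟩
  constructor
  · intro J hJ
    have hs : SES ι (LinearMap.rangeRestrict (d i)) :=
      ⟨hι, fun x => by rw [← hι0 x]; exact Subtype.ext_iff, LinearMap.surjective_rangeRestrict _⟩
    refine hs.ext1_of_lift (Ext1.of_inj (hY i)) fun φ => ?_
    obtain ⟨h, hh⟩ := hl J hJ i ((LinearMap.range (d i)).subtype.comp φ) (by
      ext x
      obtain ⟨y, hy⟩ := (φ x).2
      simp only [LinearMap.comp_apply, Submodule.subtype_apply, LinearMap.zero_apply]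
      rw [← hy, (hd i).apply_apply_eq_zero])
    exact ⟨h, by ext x; exact LinearMap.congr_fun hh x⟩
  · obtain ⟨j, rfl⟩ : ∃ j, i = j + 1 := ⟨i - 1, by ring⟩
    obtain ⟨q, hq⟩ := factor_range ι hι (d j) fun c => (hι0 _).1 ((hd j).apply_apply_eq_zero c)
    have hex : Function.Exact (LinearMap.ker (d j)).subtype (d j) := by
      intro z
      constructor
      · intro hz; exact ⟨⟨z, hz⟩, rfl⟩
      · rintro ⟨z, rfl⟩; exact z.2
    refine ⟨ModuleCat.of R (LinearMap.ker (d j)), Y j, (LinearMap.ker (d j)).subtype, q, hY j,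
      ⟨Subtype.val_injective, ?_, ?_⟩, j, (LinearMap.ker (d j)).subtype, Subtype.val_injective,
      hex⟩
    · intro z
      rw [← hex z, ← hq, map_eq_zero_iff ι hι]
    · intro m
      obtain ⟨c, hc⟩ := (hd j (ι m)).1 (hι0.apply_apply_eq_zero m)
      exact ⟨c, hι (by rw [hq, hc])⟩

theorem embed_of_cores (k : ℕ) : ∀ (M : ModuleCat.{u} R),
    Paper.CoresDimLE R (fun N => Paper.IsGorensteinInjective R N) k M →
    ∃ (G C : ModuleCat.{u} R) (i : M →ₗ[R] G) (p : G →ₗ[R] C), SES i p ∧ GIcl G ∧ FID R C := by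
  induction k with
  | zero =>
    intro M hM
    refine ⟨M, ModuleCat.of R PUnit, LinearMap.id, 0, ⟨Function.injective_id, ?_, ?_⟩,
      GIcl.of_gi hM, FID.of_inj ⟨fun _ _ _ _ _ _ _ _ _ => ⟨0, fun _ => rfl⟩⟩⟩
    · intro x; exact ⟨fun _ => ⟨x, rfl⟩, fun _ => rfl⟩
    · intro x; exact ⟨0, rfl⟩
  | succ k ih =>
    intro M hM
    rcases hM with hM | ⟨X, f, hX, hf, hQ⟩
    · exact ih M hM
    obtain ⟨G, C, i, p, hs, hG, hC⟩ := ih _ hQ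
    change (X ⧸ LinearMap.range f) →ₗ[R] G at i
    obtain ⟨-, K, I, j, g, hI, hsI, hK⟩ := hG.step
    let c : X →ₗ[R] G := i.comp (LinearMap.range f).mkQ
    have hc : ∀ x, c x = 0 ↔ ∃ m, f m = x := by
      intro x
      change i (Submodule.Quotient.mk x) = 0 ↔ _
      rw [map_eq_zero_iff i hs.inj, Submodule.Quotient.mk_eq_zero, LinearMap.mem_range]
    have hpc : ∀ x, p (c x) = 0 := fun x => hs.exact.apply_apply_eq_zero _
    let δ : (X × I) →ₗ[R] G := c.coprod (-g)
    have hδ : ∀ x y, (x, y) ∈ LinearMap.ker δ ↔ c x = g y := by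
      intro x y; simp [δ, LinearMap.mem_ker, ← sub_eq_add_neg, sub_eq_zero]
    let P := LinearMap.ker δ
    have hP : ∀ z : P, c z.1.1 = g z.1.2 := fun z => (hδ _ _).1 z.2
    let s : P →ₗ[R] I := (LinearMap.snd R X I).comp P.subtype
    refine ⟨ModuleCat.of R P, ModuleCat.of R (LinearMap.range s),
      ((LinearMap.inl R X I).comp f).codRestrict P ?_, s.rangeRestrict, ⟨?_, ?_, ?_⟩, ?_, ?_⟩
    · intro m
      change (f m, (0 : I)) ∈ LinearMap.ker δ
      rw [hδ, map_zero, hc]; exact ⟨m, rfl⟩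
    · intro x y hxy
      have : ((f x, (0 : I)) : X × I) = (f y, 0) := congrArg Subtype.val hxy
      exact hf (congrArg Prod.fst this)
    · intro z
      constructor
      · intro hz
        have h2 : z.1.2 = 0 := congrArg Subtype.val hz
        have h3 := hP z
        rw [h2, map_zero, hc] at h3
        obtain ⟨m, hm⟩ := h3
        exact ⟨m, Subtype.ext (Prod.ext hm h2.symm)⟩
      · rintro ⟨m, rfl⟩; exact Subtype.ext rfl
    · exact LinearMap.surjective_rangeRestrict _
    · refine GIcl.ext hK (GIcl.of_gi hX) (P := ModuleCat.of R P)
        (((LinearMap.inr R X I).comp j).codRestrict P ?_)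
        ((LinearMap.fst R X I).comp P.subtype) ⟨?_, ?_, ?_⟩
      · intro k
        change ((0 : X), j k) ∈ LinearMap.ker δ
        rw [hδ, map_zero, hsI.exact.apply_apply_eq_zero]
      · intro x y hxy
        have : (((0 : X), j x) : X × I) = (0, j y) := congrArg Subtype.val hxy
        exact hsI.inj (congrArg Prod.snd this)
      · intro z
        constructor
        · intro hz
          have h2 : z.1.1 = 0 := hz
          have h3 := hP z
          rw [h2, map_zero] at h3
          obtain ⟨k, hk⟩ := (hsI.exact _).1 h3.symm
          exact ⟨k, Subtype.ext (Prod.ext h2.symm hk)⟩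
        · rintro ⟨m, rfl⟩; rfl
      · intro x
        obtain ⟨y, hy⟩ := hsI.surj (c x)
        exact ⟨⟨(x, y), (hδ _ _).2 hy.symm⟩, rfl⟩
    · have hses : SES (LinearMap.range s).subtype (p.comp g) := by
        refine ⟨Subtype.val_injective, ?_, hs.surj.comp hsI.surj⟩
        intro y
        constructor
        · intro hy
          obtain ⟨q, hq⟩ := (hs.exact _).1 hy
          obtain ⟨x, rfl⟩ := Submodule.Quotient.mk_surjective _ q
          exact ⟨⟨y, ⟨(x, y), (hδ _ _).2 hq⟩, rfl⟩, rfl⟩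
        · rintro ⟨⟨_, ⟨z, rfl⟩⟩, rfl⟩
          change p (g z.1.2) = 0
          rw [← hP z, hpc]
      exact hses.fid₁ (FID.of_inj hI) hC

end ses
end GH

namespace GH

section lift
variable {R : Type u} [CommRing R]

/-- injective resolutions in terms of linear maps -/
structure IRes {M : Type u} [AddCommGroup M] [Module R M] (E : ℕ → ModuleCat.{u} R)
    (ε : M →ₗ[R] E 0) (d : ∀ i, E i →ₗ[R] E (i + 1)) : Prop where
  inj : ∀ i, Module.Injective R (E i)
  ε_inj : Function.Injective ε
  exact0 : Function.Exact ε (d 0)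
  exact : ∀ i, Function.Exact (d i) (d (i + 1))

theorem IRes.of_res {M : ModuleCat.{u} R} (I : InjectiveResolution M) :
    ∃ ε : M →ₗ[R] I.cocomplex.X 0,
      IRes (fun i => I.cocomplex.X i) ε (fun i => (I.cocomplex.d i (i + 1)).hom) := by
  refine ⟨(I.ι.f 0).hom, ⟨fun i => ?_, ?_, ?_, fun i => ?_⟩⟩
  · exact (Module.injective_iff_injective_object R _).2 (I.injective i)
  · exact (ModuleCat.mono_iff_injective (I.ι.f 0)).1 inferInstance
  · exact (ShortComplex.ShortExact.moduleCat_exact_iff_function_exact _).1 I.exact₀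
  · exact (ShortComplex.ShortExact.moduleCat_exact_iff_function_exact _).1 (I.exact_succ i)

theorem exists_ires (M : ModuleCat.{u} R) : ∃ (E : ℕ → ModuleCat.{u} R) (ε : M →ₗ[R] E 0)
    (d : ∀ i, E i →ₗ[R] E (i + 1)), IRes E ε d := by
  obtain ⟨ε, h⟩ := IRes.of_res (injectiveResolution M)
  exact ⟨_, ε, _, h⟩

/-- torsion in a direct sum -/
theorem contr_tors_dsum [IsNoetherianRing R] (a : Ideal R) {E : ℕ → ModuleCat.{u} R}
    {ε : R →ₗ[R] E 0} {d : ∀ i, E i →ₗ[R] E (i + 1)} (h : IRes E ε d) :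
    Contr (totd (fun i => torsI a (E i)) (fun i => torsMap a (d i))) := by
  classical
  have h1 : Contr (totd (fun i => (E i : Type u)) d) := Contr.base _ d ε h.ε_inj h.exact0 h.exact
  have h2 := h1.tors a (dsum_inj _ h.inj)
    (totd_totd _ d fun i x => (h.exact i).apply_apply_eq_zero x)
  let e0 : DirectSum ℕ (fun i => torsI a (E i)) →ₗ[R] DirectSum ℕ (fun i => (E i : Type u)) :=
    DirectSum.toModule R ℕ _ (fun i => (DirectSum.lof R ℕ (fun i => (E i : Type u)) i).comp
      (torsI a (E i)).subtype)
  have he0 : ∀ i (x : torsI a (E i)),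
      e0 (DirectSum.lof R ℕ (fun i => torsI a (E i)) i x) =
        DirectSum.lof R ℕ (fun i => (E i : Type u)) i x.1 := by
    intro i x; simp [e0]
  have happ : ∀ (v : DirectSum ℕ (fun i => torsI a (E i))) i, (e0 v) i = (v i).1 := by
    intro v i
    have : (DirectSum.component R ℕ (fun i => (E i : Type u)) i).comp e0 =
      (torsI a (E i)).subtype.comp (DirectSum.component R ℕ (fun i => torsI a (E i)) i) := by
      refine DirectSum.linearMap_ext R fun j => ?_
      ext x
      simp only [LinearMap.comp_apply, he0, DirectSum.component.of, Submodule.subtype_apply]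
      split_ifs with hji
      · subst hji; rfl
      · rfl
    exact LinearMap.congr_fun this v
  have hmem : ∀ v, e0 v ∈ torsI a (DirectSum ℕ (fun i => (E i : Type u))) := by
    intro v
    induction v using DirectSum.induction_on with
    | zero => rw [map_zero]; exact zero_mem _
    | of i x => exact he0 i x ▸ map_torsI a (DirectSum.lof R ℕ (fun i => (E i : Type u)) i) x.2
    | add x y hx hy => rw [map_add]; exact add_mem hx hy
  let e : DirectSum ℕ (fun i => torsI a (E i)) →ₗ[R]
      torsI a (DirectSum ℕ (fun i => (E i : Type u))) := e0.codRestrict _ hmem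
  have hbij : Function.Bijective e := by
    constructor
    · intro v w hvw
      have h3 : e0 v = e0 w := congrArg Subtype.val hvw
      apply DFinsupp.ext
      intro i
      apply Subtype.ext
      rw [← happ, ← happ, h3]
    · rintro ⟨v, hv⟩
      have hvi : ∀ i, v i ∈ torsI a (E i) := fun i =>
        map_torsI a (DirectSum.component R ℕ (fun i => (E i : Type u)) i) hv
      refine ⟨DFinsupp.mk (DFinsupp.support v) (fun i => ⟨v i, hvi i⟩), Subtype.ext ?_⟩
      apply DFinsupp.ext
      intro i
      refine (happ _ i).trans ?_
      rw [DFinsupp.mk_apply]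
      split_ifs with hi
      · rfl
      · exact (DFinsupp.notMem_support_iff.1 hi).symm
  refine h2.equiv (LinearEquiv.ofBijective e hbij).symm fun x => ?_
  obtain ⟨v, rfl⟩ := (LinearEquiv.ofBijective e hbij).surjective x
  rw [LinearEquiv.symm_apply_apply, LinearEquiv.symm_apply_eq]
  apply Subtype.ext
  change totd (fun i => (E i : Type u)) d (e0 v) =
    e0 (totd (fun i => torsI a (E i)) (fun i => torsMap a (d i)) v)
  have : (totd (fun i => (E i : Type u)) d).comp e0 =
    e0.comp (totd (fun i => torsI a (E i)) (fun i => torsMap a (d i))) := by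
    refine DirectSum.linearMap_ext R fun j => ?_
    ext x : 1
    simp only [LinearMap.comp_apply, he0, totd_lof, torsMap_coe]
  exact LinearMap.congr_fun this v

/-- boundaries -/
def Bd {T : ℕ → Type u} [∀ i, AddCommGroup (T i)] [∀ i, Module R (T i)]
    (δ : ∀ i, T i →ₗ[R] T (i + 1)) : ∀ i, Submodule R (T i)
  | 0 => ⊥
  | i + 1 => LinearMap.range (δ i)

/-- extending a cocycle to a chain map -/
theorem exists_chain (Rr : ℕ → ModuleCat.{u} R) (D : ∀ i, Rr i →ₗ[R] Rr (i + 1))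
    (hR : ∀ i, Module.Injective R (Rr i)) (hDD : ∀ i x, D (i + 1) (D i x) = 0)
    (Y : ModuleCat.{u} R) (DY : Y →ₗ[R] Y) (inc : ∀ i, Rr i →ₗ[R] Y)
    (hinc : ∀ i x, DY (inc i x) = inc (i + 1) (D i x)) (n : ℕ) :
    ∀ (T : ℕ → ModuleCat.{u} R) (δ : ∀ i, T i →ₗ[R] T (i + 1))
    (_ : ∀ i, n ≤ i → Function.Exact (δ i) (δ (i + 1)))
    (φ : T n →ₗ[R] Rr 0) (_ : ∀ z, δ n z = 0 → D 0 (φ z) = 0) (_ : Bd δ n ≤ LinearMap.ker φ),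
    ∃ f : ∀ i, T i →ₗ[R] Y, (∀ i x, DY (f i x) = f (i + 1) (δ i x)) ∧
      (∀ z, f n z = inc 0 (φ z)) ∧ (0 < n → f 0 = 0) := by
  induction n with
  | zero =>
    intro T δ hT φ hφ _
    obtain ⟨f, hf0, -, hf⟩ := exists_dep_seq (α := fun i => T i →ₗ[R] Rr i)
      (fun i s => ∀ x, δ i x = 0 → D i (s x) = 0)
      (fun i s t => ∀ x, D i (s x) = t (δ i x)) φ hφ (by
        intro i s hs
        obtain ⟨t, ht⟩ := ext_of_ker_le (hR (i + 1)) (δ i) ((D i).comp s) hs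
        have ht' := LinearMap.congr_fun ht
        simp only [LinearMap.comp_apply] at ht'
        refine ⟨t, ?_, fun x => (ht' x).symm⟩
        intro x hx
        obtain ⟨y, rfl⟩ := (hT i (Nat.zero_le _) x).1 hx
        rw [ht', hDD])
    refine ⟨fun i => (inc i).comp (f i), fun i x => ?_, fun z => ?_, fun h => absurd h (by simp)⟩
    · simp only [LinearMap.comp_apply, hinc, hf]
    · simp only [LinearMap.comp_apply, hf0]
  | succ n ih =>
    intro T δ hT φ hφ hB
    obtain ⟨f, hf1, hf2, hf3⟩ := ih (fun i => T (i + 1)) (fun i => δ (i + 1))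
      (fun i hi => hT (i + 1) (by omega)) φ hφ (by
        rcases n with _ | n
        · exact bot_le
        · exact hB)
    refine ⟨fun i => match i with
      | 0 => 0
      | i + 1 => f i, ?_, ?_, fun _ => rfl⟩
    · intro i x
      rcases i with _ | i
      · change DY 0 = f 0 (δ 0 x)
        rcases n with _ | n
        · have : φ (δ 0 x) = 0 := hB ⟨x, rfl⟩
          rw [hf2, this, map_zero, map_zero]
        · rw [hf3 (by omega), map_zero]; rfl
      · exact hf1 i x
    · exact hf2

theorem lift_cocycle {T : ℕ → ModuleCat.{u} R} {δ : ∀ i, T i →ₗ[R] T (i + 1)}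
    (hC : Contr (totd (fun i => (T i : Type u)) δ)) (n : ℕ)
    (hT : ∀ i, n ≤ i → Function.Exact (δ i) (δ (i + 1)))
    {G : ModuleCat.{u} R} (hG : GIcl G) (φ : LinearMap.ker (δ n) →ₗ[R] G)
    (hφ : ∀ z : LinearMap.ker (δ n), (z : T n) ∈ Bd δ n → φ z = 0) :
    ∃ (I : ModuleCat.{u} R) (p : I →ₗ[R] G) (ψ : LinearMap.ker (δ n) →ₗ[R] I),
      Module.Injective R I ∧ p.comp ψ = φ := by
  classical
  obtain ⟨Rr, η, D, hR⟩ := exists_ires G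
  obtain ⟨M, hM0, hM1, hM⟩ := exists_dep_seq (α := fun _ => ModuleCat.{u} R) (fun _ M => GIcl M)
    (fun _ M M' => ∃ (I : ModuleCat.{u} R) (j : M' →ₗ[R] I) (f : I →ₗ[R] M),
      Module.Injective R I ∧ SES j f) G hG (by
      intro _ M hM
      obtain ⟨-, K, I, j, f, h1, h2, h3⟩ := hM.step
      exact ⟨K, h3, I, j, f, h1, h2⟩)
  subst hM0
  choose L j p hL hs using hM
  let lam : ∀ i, L (i + 1) →ₗ[R] L i := fun i => (j i).comp (p (i + 1))
  let Y : ModuleCat.{u} R := ModuleCat.of R ((∀ i, L i) × (∀ i, Rr i))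
  let DR : ((∀ i, L i) × (∀ i, Rr i)) →ₗ[R] (∀ i, Rr i) := LinearMap.pi (fun i => match i with
    | 0 => η.comp ((p 0).comp ((LinearMap.proj 0).comp (LinearMap.fst R _ _)))
    | i + 1 => (D i).comp ((LinearMap.proj i).comp (LinearMap.snd R _ _)))
  let DL : ((∀ i, L i) × (∀ i, Rr i)) →ₗ[R] (∀ i, L i) :=
    LinearMap.pi (fun i => (lam i).comp ((LinearMap.proj (i + 1)).comp (LinearMap.fst R _ _)))
  let DY : Y →ₗ[R] Y := DL.prod DR
  have hDL : ∀ y i, (DY y).1 i = j i (p (i + 1) (y.1 (i + 1))) := fun y i => rfl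
  have hDR0 : ∀ y, (DY y).2 0 = η (p 0 (y.1 0)) := fun y => rfl
  have hDR : ∀ y i, (DY y).2 (i + 1) = D i (y.2 i) := fun y i => rfl
  have hYinj : Module.Injective R Y := by
    have h1 : Module.Injective R (∀ i, L i) := Module.Injective.pi R _
    have h2 : Module.Injective R (∀ i, Rr i) :=
      have := hR.inj
      Module.Injective.pi R _
    refine ⟨fun A B _ _ _ _ m hm e => ?_⟩
    obtain ⟨e1, h1⟩ := h1.out m hm ((LinearMap.fst R _ _).comp e)
    obtain ⟨e2, h2⟩ := h2.out m hm ((LinearMap.snd R _ _).comp e)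
    exact ⟨e1.prod e2, fun x => Prod.ext (h1 x) (h2 x)⟩
  have hex : Function.Exact DY DY := by
    intro y
    constructor
    · intro hy
      have hL' : ∀ i, j i (p (i + 1) (y.1 (i + 1))) = 0 := fun i => by
        rw [← hDL, hy]; rfl
      have hR0 : η (p 0 (y.1 0)) = 0 := by rw [← hDR0, hy]; rfl
      have hRi : ∀ i, D i (y.2 i) = 0 := fun i => by rw [← hDR, hy]; rfl
      have hp : ∀ i, p i (y.1 i) = 0 := by
        intro i
        rcases i with _ | i
        · exact (map_eq_zero_iff η hR.ε_inj).1 hR0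
        · exact (map_eq_zero_iff (j i) (hs i).inj).1 (hL' i)
      have h1 : ∀ i, ∃ l : L (i + 1), j i (p (i + 1) l) = y.1 i := by
        intro i
        obtain ⟨m, hm⟩ := ((hs i).exact _).1 (hp i)
        obtain ⟨l, rfl⟩ := (hs (i + 1)).surj m
        exact ⟨l, hm⟩
      choose l hl using h1
      have h2 : ∀ i, ∃ r : Rr i, D i r = y.2 (i + 1) := fun i => (hR.exact i _).1 (hRi (i + 1))
      choose r hr using h2
      obtain ⟨g, hg⟩ := (hR.exact0 _).1 (hRi 0)
      obtain ⟨l0, rfl⟩ := (hs 0).surj g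
      refine ⟨(fun i => match i with
        | 0 => l0
        | i + 1 => l i, r), ?_⟩
      apply Prod.ext
      · funext i; exact hl i
      · funext i
        rcases i with _ | i
        · exact hg
        · exact hr i
    · rintro ⟨z, rfl⟩
      apply Prod.ext
      · funext i
        rw [hDL, hDL, (hs (i + 1)).exact.apply_apply_eq_zero, map_zero]; rfl
      · funext i
        rcases i with _ | i
        · rw [hDR0, hDL, (hs 0).exact.apply_apply_eq_zero, map_zero]; rfl
        · rw [hDR]
          rcases i with _ | i
          · rw [hDR0, hR.exact0.apply_apply_eq_zero]; rfl
          · rw [hDR, (hR.exact i).apply_apply_eq_zero]; rfl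
  let inc : ∀ i, Rr i →ₗ[R] Y := fun i =>
    (LinearMap.inr R (∀ i, L i) (∀ i, Rr i)).comp (LinearMap.single R (fun i => (Rr i : Type u)) i)
  have hinc : ∀ i x, DY (inc i x) = inc (i + 1) (D i x) := by
    intro i x
    apply Prod.ext
    · funext k
      change lam k 0 = 0
      rw [map_zero]
    · funext k
      rcases k with _ | k
      · change η (p 0 0) = (Pi.single (i + 1) (D i x) : ∀ i, Rr i) 0
        rw [map_zero, map_zero, Pi.single_eq_of_ne (by omega)]
      · change D k ((Pi.single i x : ∀ i, Rr i) k) = (Pi.single (i + 1) (D i x) : ∀ i, Rr i) (k + 1)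
        by_cases hk : k = i
        · subst hk; rw [Pi.single_eq_same, Pi.single_eq_same]
        · rw [Pi.single_eq_of_ne hk, Pi.single_eq_of_ne (by omega), map_zero]
  obtain ⟨Φ, hΦ⟩ := ext_of_ker_le (hR.inj 0) ((Bd δ n).mkQ.comp (LinearMap.ker (δ n)).subtype)
    (η.comp φ) (by
      intro z hz
      have : (z : T n) ∈ Bd δ n := (Submodule.Quotient.mk_eq_zero _).1 hz
      simp [hφ z this])
  have hΦ' : ∀ z : LinearMap.ker (δ n), Φ ((Bd δ n).mkQ (z : T n)) = η (φ z) :=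
    LinearMap.congr_fun hΦ
  obtain ⟨f, hf1, hf2, -⟩ := exists_chain Rr D hR.inj
    (fun i x => (hR.exact i).apply_apply_eq_zero x) Y DY inc hinc n T δ hT (Φ.comp (Bd δ n).mkQ)
    (by
      intro z hz
      have := hΦ' ⟨z, hz⟩
      simp only [LinearMap.comp_apply]
      rw [this, hR.exact0.apply_apply_eq_zero])
    (by
      intro z hz
      have : (Bd δ n).mkQ z = 0 := (Submodule.Quotient.mk_eq_zero _).2 hz
      rw [LinearMap.mem_ker, LinearMap.comp_apply, this, map_zero])
  obtain ⟨s, hs'⟩ := hC Y DY hYinj hex (DirectSum.toModule R ℕ Y f) (by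
    refine DirectSum.linearMap_ext R fun i => ?_
    ext x : 1
    simp only [LinearMap.comp_apply, totd_lof, DirectSum.toModule_lof, hf1])
  let sn : T n →ₗ[R] Y := s.comp (DirectSum.lof R ℕ (fun i => (T i : Type u)) n)
  refine ⟨L 0, p 0, ((LinearMap.proj 0).comp (LinearMap.fst R (∀ i, L i) (∀ i, Rr i))).comp
    (sn.comp (LinearMap.ker (δ n)).subtype), hL 0, ?_⟩
  ext z
  apply hR.ε_inj
  have h1 := LinearMap.congr_fun hs' (DirectSum.lof R ℕ (fun i => (T i : Type u)) n z.1)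
  simp only [LinearMap.comp_apply, LinearMap.add_apply, totd_lof, DirectSum.toModule_lof] at h1
  have hz : δ n z.1 = 0 := z.2
  have h3 : (Φ.comp (Bd δ n).mkQ) z.1 = η (φ z) := hΦ' z
  rw [hz, map_zero, map_zero, add_zero, hf2, h3] at h1
  have h2 : (inc 0 (η (φ z))).2 0 = (DY (sn z.1)).2 0 := congrArg (fun y : Y => y.2 0) h1
  rw [hDR0] at h2
  have h4 : (inc 0 (η (φ z))).2 0 = η (φ z) :=
    Pi.single_eq_same (M := fun i => (Rr i : Type u)) 0 (η (φ z))
  exact h2.symm.trans h4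

theorem fid_of_factor {H G C I : Type u} [AddCommGroup H] [Module R H] [AddCommGroup G] [Module R G]
    [AddCommGroup C] [Module R C] [AddCommGroup I] [Module R I] {i : H →ₗ[R] G} {p : G →ₗ[R] C}
    (h : SES i p) (hC : FID R C) (hI : Module.Injective R I) (ψ : H →ₗ[R] I) (q : I →ₗ[R] G)
    (hq : q.comp ψ = i) : FID R H := by
  refine h.fid₁ ?_ hC
  obtain ⟨N, hN⟩ := hC
  have := (Module.injective_iff_injective_object R I).1 hI
  refine ⟨N + 1, ?_⟩
  rw [hasInjectiveDimensionLT_iff]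
  intro k hk T x
  obtain ⟨y, hy⟩ := Abelian.Ext.covariant_sequence_exact₂ T h.short x
    ((HasInjectiveDimensionLT.subsingleton (ModuleCat.of R C) N k (by omega) T).elim _ _)
  have h1 : h.cplx.f = ModuleCat.ofHom ψ ≫ ModuleCat.ofHom q := by
    rw [← ModuleCat.ofHom_comp, hq]
  obtain ⟨k, rfl⟩ : ∃ k', k = k' + 1 := ⟨k - 1, by omega⟩
  rw [h1, ← Abelian.Ext.mk₀_comp_mk₀, ← Abelian.Ext.comp_assoc (a₁₂ := k + 1) _ _ _ (by simp)
    (by simp) (by simp), Abelian.Ext.eq_zero_of_injective (I := ModuleCat.of R I) (Abelian.Ext.comp _ _ _),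
    Abelian.Ext.zero_comp] at hy
  exact hy.symm

end lift
end GH

namespace GH
open Opposite

section oldext
variable {R : Type u} [CommRing R]

/-- the additive functor derived to get `Ext` -/
noncomputable abbrev YF (Y : ModuleCat.{u} R) : ModuleCat.{u} R ⥤ (ModuleCat.{u} R)ᵒᵖ :=
  ((linearYoneda R (ModuleCat.{u} R)).obj Y).rightOp

noncomputable abbrev KP {A : ModuleCat.{u} R} (P : ProjectiveResolution A) (Y : ModuleCat.{u} R) :
    ChainComplex (ModuleCat.{u} R)ᵒᵖ ℕ :=
  ((YF Y).mapHomologicalComplex _).obj P.complex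

noncomputable abbrev oExt (n : ℕ) (A Y : ModuleCat.{u} R) : ModuleCat.{u} R :=
  ((Ext R (ModuleCat.{u} R) n).obj (op A)).obj Y

noncomputable def lIso {A : ModuleCat.{u} R} (P : ProjectiveResolution A) (Y : ModuleCat.{u} R)
    (n : ℕ) : ((YF Y).leftDerived n).obj A ≅ (KP P Y).homology n :=
  P.isoLeftDerivedObj (YF Y) n

noncomputable def jMap {A : ModuleCat.{u} R} (P : ProjectiveResolution A) (Y : ModuleCat.{u} R) (n : ℕ) :
    ((KP P Y).opcycles n).unop →ₗ[R] (P.complex.X n ⟶ Y) :=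
  ((KP P Y).pOpcycles n).unop.hom

noncomputable def qMap {A : ModuleCat.{u} R} (P : ProjectiveResolution A) (Y : ModuleCat.{u} R) (n : ℕ) :
    ((KP P Y).opcycles n).unop →ₗ[R] oExt n A Y :=
  ((lIso P Y n).hom ≫ (KP P Y).homologyι n).unop.hom

theorem jMap_inj {A : ModuleCat.{u} R} (P : ProjectiveResolution A) (Y : ModuleCat.{u} R) (n : ℕ) :
    Function.Injective (jMap P Y n) :=
  (ModuleCat.mono_iff_injective ((KP P Y).pOpcycles n).unop).1 inferInstance

theorem qMap_surj {A : ModuleCat.{u} R} (P : ProjectiveResolution A) (Y : ModuleCat.{u} R) (n : ℕ) :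
    Function.Surjective (qMap P Y n) :=
  (ModuleCat.epi_iff_surjective
    ((lIso P Y n).hom ≫ (KP P Y).homologyι n).unop).1 inferInstance

theorem jMap_range {A : ModuleCat.{u} R} (P : ProjectiveResolution A) (Y : ModuleCat.{u} R) (n : ℕ)
    (ψ : P.complex.X n ⟶ Y) : P.complex.d (n + 1) n ≫ ψ = 0 ↔ ∃ z, jMap P Y n z = ψ := by
  have h := (ShortComplex.exact_of_g_is_cokernel
    (ShortComplex.mk _ _ ((KP P Y).d_pOpcycles (n + 1) n))
    ((KP P Y).opcyclesIsCokernel (n + 1) n (by simp))).unop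
  have h2 := (ShortComplex.ShortExact.moduleCat_exact_iff_function_exact _).1 h
  exact h2 ψ

theorem qMap_zero {A : ModuleCat.{u} R} (P : ProjectiveResolution A) (Y : ModuleCat.{u} R) (n : ℕ)
    (z) : qMap P Y (n + 1) z = 0 ↔ ∃ g : P.complex.X n ⟶ Y, P.complex.d (n + 1) n ≫ g =
      jMap P Y (n + 1) z := by
  have h := (ShortComplex.exact_of_f_is_kernel
    (ShortComplex.mk _ _ ((KP P Y).homologyι_comp_fromOpcycles (n + 1) n))
    ((KP P Y).homologyIsKernel (n + 1) n (by simp))).unop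
  have h2 := (ShortComplex.ShortExact.moduleCat_exact_iff_function_exact _).1 h
  have h1 : ∀ z, qMap P Y (n + 1) z = 0 ↔ ((KP P Y).homologyι (n + 1)).unop.hom z = 0 := by
    intro z
    have : Function.Injective (lIso P Y (n+1)).hom.unop.hom :=
      (ModuleCat.mono_iff_injective _).1 inferInstance
    exact map_eq_zero_iff _ this
  rw [h1]
  refine (h2 z).trans ⟨?_, ?_⟩
  · rintro ⟨g, hg⟩
    refine ⟨g, ?_⟩
    rw [← hg]
    have := (KP P Y).p_fromOpcycles (n + 1) n
    have := congrArg (fun f => f.unop.hom g) this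
    exact this.symm
  · rintro ⟨g, hg⟩
    refine ⟨g, jMap_inj P Y (n + 1) ?_⟩
    rw [← hg]
    have := (KP P Y).p_fromOpcycles (n + 1) n
    have := congrArg (fun f => f.unop.hom g) this
    exact this

theorem qMap_zero0 {A : ModuleCat.{u} R} (P : ProjectiveResolution A) (Y : ModuleCat.{u} R)
    (z) : qMap P Y 0 z = 0 ↔ jMap P Y 0 z = 0 := by
  have h1 : Function.Injective (qMap P Y 0) :=
    (ModuleCat.mono_iff_injective
      ((lIso P Y 0).hom ≫ (KP P Y).homologyι 0).unop).1 inferInstance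
  rw [map_eq_zero_iff _ h1, map_eq_zero_iff _ (jMap_inj P Y 0)]

theorem jq_nat {A A' : ModuleCat.{u} R} {P : ProjectiveResolution A} {P' : ProjectiveResolution A'}
    {g : A' ⟶ A} (φ : P'.Hom P g) (Y : ModuleCat.{u} R) (n : ℕ) (z) :
    ∃ z', jMap P' Y n z' = φ.hom.f n ≫ jMap P Y n z ∧
      qMap P' Y n z' = (((Ext R (ModuleCat.{u} R) n).map g.op).app Y).hom (qMap P Y n z) := by
  let Φ : KP P' Y ⟶ KP P Y := ((YF Y).mapHomologicalComplex _).map φ.hom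
  refine ⟨(HomologicalComplex.opcyclesMap Φ n).unop.hom z, ?_, ?_⟩
  · have := HomologicalComplex.p_opcyclesMap Φ n
    exact congrArg (fun f => f.unop.hom z) this
  · have h1 : ((YF Y).leftDerived n).map g ≫ (lIso P Y n).hom = (lIso P' Y n).hom ≫
        HomologicalComplex.homologyMap Φ n := ProjectiveResolution.isoLeftDerivedObj_hom_naturality g P' P φ.hom
      (by simpa using φ.hom_f_zero_comp_π_f_zero) (YF Y) n
    have h2 := HomologicalComplex.homologyι_naturality Φ n
    have h3 : ((YF Y).leftDerived n).map g ≫ (lIso P Y n).hom ≫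
        (KP P Y).homologyι n = (lIso P' Y n).hom ≫ (KP P' Y).homologyι n ≫
          HomologicalComplex.opcyclesMap Φ n := by
      rw [reassoc_of% h1, ← h2]
    exact (congrArg (fun f => f.unop.hom z) h3).symm

end oldext
end GH

namespace GH
open Opposite

section cmp
variable {R : Type u} [CommRing R]
open CochainComplex CochainComplex.HomComplex

theorem iExtMk_zero0 {X Y : ModuleCat.{u} R} (I : InjectiveResolution Y)
    (f : X ⟶ I.cocomplex.X 0) (hf : f ≫ I.cocomplex.d 0 1 = 0) :
    I.extMk f 1 rfl hf = 0 ↔ f = 0 := by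
  constructor
  · intro h
    rw [← I.extEquivCohomologyClass.apply_eq_iff_eq,
      InjectiveResolution.extEquivCohomologyClass_extMk,
      InjectiveResolution.extEquivCohomologyClass_zero,
      CohomologyClass.mk_eq_zero_iff] at h
    rw [Cocycle.fromSingleMk_mem_coboundaries_iff _ _ _ _ _ (-1) (by simp)] at h
    obtain ⟨g, hg⟩ := h
    have hz : Limits.IsZero (I.cochainComplex.X (-1)) :=
      CochainComplex.isZero_of_isStrictlyGE I.cochainComplex 0 (-1) (by norm_num)
    rw [hz.eq_of_tgt g 0, Limits.zero_comp] at hg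
    rw [← cancel_mono (I.cochainComplexXIso ((0 : ℕ) : ℤ) 0 rfl).inv, ← hg, Limits.zero_comp]
  · rintro rfl
    simp

theorem pExtMk_zero0 {X Y : ModuleCat.{u} R} (P : ProjectiveResolution X)
    (f : P.complex.X 0 ⟶ Y) (hf : P.complex.d 1 0 ≫ f = 0) :
    P.extMk f 1 rfl hf = 0 ↔ f = 0 := by
  constructor
  · intro h
    rw [← P.extEquivCohomologyClass.apply_eq_iff_eq,
      ProjectiveResolution.extEquivCohomologyClass_extMk,
      ProjectiveResolution.extEquivCohomologyClass_zero,
      CohomologyClass.mk_eq_zero_iff] at h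
    rw [Cocycle.toSingleMk_mem_coboundaries_iff _ _ _ _ _ 1 (by simp)] at h
    obtain ⟨g, hg⟩ := h
    have hz : Limits.IsZero (P.cochainComplex.X 1) :=
      CochainComplex.isZero_of_isStrictlyLE P.cochainComplex 0 1 (by norm_num)
    rw [hz.eq_of_src g 0, Limits.comp_zero] at hg
    rw [← cancel_epi (P.cochainComplexXIso (-((0 : ℕ) : ℤ)) 0 rfl).hom, ← hg, Limits.comp_zero]
  · rintro rfl
    simp

noncomputable abbrev pr (A : ModuleCat.{u} R) : ProjectiveResolution A := projectiveResolution A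

noncomputable def thetaFun (n : ℕ) (A Y : ModuleCat.{u} R) (z : ((KP (pr A) Y).opcycles n).unop) :
    Abelian.Ext A Y n :=
  (pr A).extMk (jMap (pr A) Y n z) (n + 1) rfl ((jMap_range (pr A) Y n _).2 ⟨z, rfl⟩)

noncomputable def theta (n : ℕ) (A Y : ModuleCat.{u} R) :
    ((KP (pr A) Y).opcycles n).unop →ₗ[R] Abelian.Ext A Y n where
  toFun := thetaFun n A Y
  map_add' z w := by
    simp only [thetaFun, map_add]
    rw [ProjectiveResolution.add_extMk]
  map_smul' r z := by
    simp only [thetaFun, map_smul, RingHom.id_apply]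
    rw [Abelian.Ext.smul_eq_comp_mk₀, ProjectiveResolution.extMk_comp_mk₀]
    congr 1

theorem theta_zero (n : ℕ) (A Y : ModuleCat.{u} R) (z) :
    theta n A Y z = 0 ↔ qMap (pr A) Y n z = 0 := by
  cases n with
  | zero => exact (pExtMk_zero0 _ _ ((jMap_range (pr A) Y 0 _).2 ⟨z, rfl⟩)).trans (qMap_zero0 _ _ _).symm
  | succ n => exact (ProjectiveResolution.extMk_eq_zero_iff _ _ _ rfl
      ((jMap_range (pr A) Y (n + 1) _).2 ⟨z, rfl⟩) n rfl).trans
                (qMap_zero _ _ _ _).symm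

theorem theta_surj (n : ℕ) (A Y : ModuleCat.{u} R) : Function.Surjective (theta n A Y) := by
  intro α
  obtain ⟨f, hf, rfl⟩ := (pr A).extMk_surjective α (n + 1) rfl
  obtain ⟨z, rfl⟩ := (jMap_range _ _ _ _).1 hf
  exact ⟨z, rfl⟩

/-- The comparison between the two kinds of `Ext` -/
theorem exists_Theta (n : ℕ) (A Y : ModuleCat.{u} R) : ∃ e : oExt n A Y ≃ₗ[R] Abelian.Ext A Y n,
    ∀ z, e (qMap (pr A) Y n z) = theta n A Y z := by
  have hk : LinearMap.ker (qMap (pr A) Y n) = LinearMap.ker (theta n A Y) := by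
    ext z; exact (theta_zero n A Y z).symm
  let e1 := (qMap (pr A) Y n).quotKerEquivOfSurjective (qMap_surj _ _ _)
  let e2 := (theta n A Y).quotKerEquivOfSurjective (theta_surj _ _ _)
  refine ⟨e1.symm.trans ((Submodule.quotEquivOfEq _ _ hk).trans e2), fun z => ?_⟩
  have : e1.symm (qMap (pr A) Y n z) = Submodule.Quotient.mk z := by
    rw [LinearEquiv.symm_apply_eq]; rfl
  simp only [LinearEquiv.trans_apply, this]
  rfl

noncomputable def Theta (n : ℕ) (A Y : ModuleCat.{u} R) : oExt n A Y ≃ₗ[R] Abelian.Ext A Y n :=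
  (exists_Theta n A Y).choose

theorem Theta_nat (n : ℕ) {A A' : ModuleCat.{u} R} (g : A' ⟶ A) (Y : ModuleCat.{u} R)
    (x : oExt n A Y) :
    Theta n A' Y ((((Ext R (ModuleCat.{u} R) n).map g.op).app Y).hom x) =
      (Abelian.Ext.mk₀ g).comp (Theta n A Y x) (zero_add _) := by
  obtain ⟨z, rfl⟩ := qMap_surj (pr A) Y n x
  have φ : (pr A').Hom (pr A) g := ⟨ProjectiveResolution.lift g _ _, by
    have := ProjectiveResolution.lift_commutes g (pr A') (pr A)
    exact congrArg (fun f => HomologicalComplex.Hom.f f 0) this⟩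
  obtain ⟨z', h1, h2⟩ := jq_nat φ Y n z
  rw [← h2, Theta, (exists_Theta n A' Y).choose_spec, Theta, (exists_Theta n A Y).choose_spec]
  refine Eq.trans ?_ (ProjectiveResolution.mk₀_comp_extMk _ _ rfl
    ((jMap_range (pr A) Y n _).2 ⟨z, rfl⟩) φ).symm
  simp only [theta, LinearMap.coe_mk, AddHom.coe_mk, thetaFun, h1]

/-- `x` is represented by the cocycle `f` -/
def ERel {Y : ModuleCat.{u} R} (I : InjectiveResolution Y) (n : ℕ) {A : ModuleCat.{u} R}
    (x : oExt n A Y) (f : A ⟶ I.cocomplex.X n) : Prop :=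
  ∃ hf : f ≫ I.cocomplex.d n (n + 1) = 0, Theta n A Y x = I.extMk f (n + 1) rfl hf

variable {Y : ModuleCat.{u} R} {I : InjectiveResolution Y} {n : ℕ} {A A' : ModuleCat.{u} R}

theorem ERel.add {x y : oExt n A Y} {f g} (h : ERel I n x f) (h' : ERel I n y g) :
    ERel I n (x + y) (f + g) := by
  obtain ⟨hf, h⟩ := h
  obtain ⟨hg, h'⟩ := h'
  exact ⟨by simp [hf, hg], by rw [map_add, h, h', InjectiveResolution.add_extMk]⟩

theorem ERel.smul {x : oExt n A Y} {f} (r : R) (h : ERel I n x f) :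
    ERel I n (r • x) (r • f) := by
  obtain ⟨hf, h⟩ := h
  refine ⟨by simp [hf], ?_⟩
  rw [map_smul, h]
  have h1 : (Abelian.Ext.mk₀ (r • 𝟙 A)).comp (I.extMk f (n + 1) rfl hf) (zero_add _) =
      r • (I.extMk f (n + 1) rfl hf) := by
    rw [Abelian.Ext.mk₀_smul, Abelian.Ext.smul_comp, Abelian.Ext.mk₀_id_comp]
  rw [← h1, InjectiveResolution.mk₀_comp_extMk]
  congr 1
  simp

theorem ERel.map {x : oExt n A Y} {f} (h : ERel I n x f) (g : A' ⟶ A) :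
    ERel I n ((((Ext R (ModuleCat.{u} R) n).map g.op).app Y).hom x) (g ≫ f) := by
  obtain ⟨hf, h⟩ := h
  refine ⟨by simp [hf], ?_⟩
  rw [Theta_nat, h, InjectiveResolution.mk₀_comp_extMk]

theorem ERel.exists (I : InjectiveResolution Y) (x : oExt n A Y) : ∃ f, ERel I n x f := by
  obtain ⟨f, hf, h⟩ := I.extMk_surjective (Theta n A Y x) (n + 1) rfl
  exact ⟨f, hf, h.symm⟩

theorem ERel.exists' (I : InjectiveResolution Y) (f : A ⟶ I.cocomplex.X n)
    (hf : f ≫ I.cocomplex.d n (n + 1) = 0) : ∃ x, ERel I n x f := by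
  obtain ⟨x, hx⟩ := (Theta n A Y).surjective (I.extMk f (n + 1) rfl hf)
  exact ⟨x, hf, hx⟩

theorem ERel.zero_iff_succ {x : oExt (n + 1) A Y} {f} (h : ERel I (n + 1) x f) :
    x = 0 ↔ ∃ g : A ⟶ I.cocomplex.X n, g ≫ I.cocomplex.d n (n + 1) = f := by
  obtain ⟨hf, h⟩ := h
  rw [← InjectiveResolution.extMk_eq_zero_iff (hf := hf) (hp := rfl) (hm := rfl), ← h,
    LinearEquiv.map_eq_zero_iff]

theorem ERel.zero_iff0 {x : oExt 0 A Y} {f} (h : ERel I 0 x f) : x = 0 ↔ f = 0 := by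
  obtain ⟨hf, h⟩ := h
  rw [← iExtMk_zero0 I f hf, ← h, LinearEquiv.map_eq_zero_iff]

end cmp
end GH

namespace GH
open Opposite

section lc
variable {R : Type u} [CommRing R]

theorem linear_of_rel {M N : Type u} [AddCommGroup M] [Module R M] [AddCommGroup N] [Module R N]
    (Q : M → N → Prop) (h1 : ∀ x, ∃ y, Q x y) (h2 : ∀ x x' y y', Q x y → Q x' y' → Q (x + x') (y + y'))
    (h3 : ∀ (r : R) x y, Q x y → Q (r • x) (r • y)) (h4 : ∀ y, Q 0 y → y = 0) :
    ∃ L : M →ₗ[R] N, ∀ x y, Q x y ↔ y = L x := by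
  choose L hL using h1
  have h5 : ∀ x y y', Q x y → Q x y' → y = y' := by
    intro x y y' h h'
    have := h2 _ _ _ _ h (h3 (-1) _ _ h')
    simp only [neg_smul, one_smul, add_neg_cancel] at this
    exact add_neg_eq_zero.1 (h4 _ this)
  exact ⟨⟨⟨L, fun x y => h5 _ _ _ (hL _) (h2 _ _ _ _ (hL _) (hL _))⟩,
    fun r x => h5 _ _ _ (hL _) (h3 _ _ _ (hL _))⟩, fun x y => ⟨fun h => h5 _ _ _ h (hL _),
      fun h => h ▸ hL x⟩⟩

theorem colim_rep {D : (ℕᵒᵖ)ᵒᵖ ⥤ ModuleCat.{u} R} {c : Limits.Cocone D} (hc : Limits.IsColimit c)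
    (x : c.pt) : ∃ s y, (c.ι.app s).hom y = x := by
  let N : ℕ → Submodule R c.pt := fun s => LinearMap.range (c.ι.app (op (op s))).hom
  have hmono : Monotone N := by
    rintro s t hst _ ⟨y, rfl⟩
    refine ⟨(D.map (Quiver.Hom.op (Quiver.Hom.op (homOfLE hst)))).hom y, ?_⟩
    rw [← LinearMap.comp_apply, ← ModuleCat.hom_comp, c.w]
  have htop : (⨆ s, N s) = ⊤ := by
    have h1 : ModuleCat.ofHom (⨆ s, N s).mkQ = 0 := by
      refine hc.hom_ext fun s => ?_
      ext y
      simp only [ModuleCat.hom_comp, LinearMap.comp_apply]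
      refine (Submodule.Quotient.mk_eq_zero _).2 (Submodule.mem_iSup_of_mem (s.unop.unop) ⟨y, rfl⟩)
    rw [← Submodule.ker_mkQ (⨆ s, N s), LinearMap.ker_eq_top]
    exact congrArg ModuleCat.Hom.hom h1
  have hx : x ∈ ⨆ s, N s := htop ▸ Submodule.mem_top
  obtain ⟨s, y, hy⟩ := (Submodule.mem_iSup_of_directed N hmono.directed_le).1 hx
  exact ⟨_, y, hy⟩

variable {Y : ModuleCat.{u} R}

noncomputable abbrev TI (a : Ideal R) (I : InjectiveResolution Y) (i : ℕ) : ModuleCat.{u} R :=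
  ModuleCat.of R (torsI a (I.cocomplex.X i))

noncomputable abbrev Td (a : Ideal R) (I : InjectiveResolution Y) (i : ℕ) :
    TI a I i →ₗ[R] TI a I (i + 1) := torsMap a (I.cocomplex.d i (i + 1)).hom

/-- concrete local cohomology -/
abbrev HI (a : Ideal R) (I : InjectiveResolution Y) (n : ℕ) : Type u :=
  LinearMap.ker (Td a I n) ⧸ (Bd (T := fun i => TI a I i) (Td a I) n).comap
    (LinearMap.ker (Td a I n)).subtype

noncomputable abbrev As (a : Ideal R) (s : ℕ) : ModuleCat.{u} R := ModuleCat.of R (R ⧸ a ^ s)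

def lamRel (a : Ideal R) (I : InjectiveResolution Y) (n s : ℕ) (x : oExt n (As a s) Y)
    (h : HI a I n) : Prop :=
  ∃ f : As a s ⟶ I.cocomplex.X n, ERel I n x f ∧ ∃ z : LinearMap.ker (Td a I n),
    (z.1.1 : I.cocomplex.X n) = f.hom (Submodule.Quotient.mk 1) ∧ h = Submodule.Quotient.mk z

theorem lamRel.total (a : Ideal R) (I : InjectiveResolution Y) (n s : ℕ) (x : oExt n (As a s) Y) :
    ∃ h, lamRel a I n s x h := by
  obtain ⟨f, hf⟩ := ERel.exists I x
  refine ⟨_, f, hf, ⟨⟨f.hom (Submodule.Quotient.mk 1), ⟨s, fun r hr => ?_⟩⟩, ?_⟩, rfl, rfl⟩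
  · rw [← map_smul, ← Submodule.Quotient.mk_smul, smul_eq_mul, mul_one,
      (Submodule.Quotient.mk_eq_zero _).2 hr, map_zero]
  · rw [LinearMap.mem_ker]
    apply Subtype.ext
    exact congrArg (fun g => g.hom (Submodule.Quotient.mk 1)) hf.1

theorem lamRel.add {a : Ideal R} {I : InjectiveResolution Y} {n s : ℕ} {x x' : oExt n (As a s) Y}
    {h h'} (hx : lamRel a I n s x h) (hx' : lamRel a I n s x' h') :
    lamRel a I n s (x + x') (h + h') := by
  obtain ⟨f, hf, z, hz, rfl⟩ := hx
  obtain ⟨f', hf', z', hz', rfl⟩ := hx'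
  refine ⟨f + f', hf.add hf', z + z', ?_, rfl⟩
  simp [hz, hz']

theorem lamRel.smul {a : Ideal R} {I : InjectiveResolution Y} {n s : ℕ} {x : oExt n (As a s) Y}
    {h} (r : R) (hx : lamRel a I n s x h) : lamRel a I n s (r • x) (r • h) := by
  obtain ⟨f, hf, z, hz, rfl⟩ := hx
  refine ⟨r • f, hf.smul r, r • z, ?_, rfl⟩
  simp [hz]

/-- ext for maps out of cyclic modules -/
theorem As_ext {a : Ideal R} {s : ℕ} {M : ModuleCat.{u} R} (f g : As a s ⟶ M)
    (h : f.hom (Submodule.Quotient.mk 1) = g.hom (Submodule.Quotient.mk 1)) : f = g := by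
  ext : 1
  refine Submodule.linearMap_qext _ ?_
  ext
  exact h

theorem As_lift {a : Ideal R} {s : ℕ} {M : ModuleCat.{u} R} (v : M) (h : ∀ r ∈ a ^ s, r • v = 0) :
    ∃ f : As a s ⟶ M, f.hom (Submodule.Quotient.mk 1) = v := by
  have h' : a ^ s ≤ LinearMap.ker (LinearMap.toSpanSingleton R M v) := fun r hr => h r hr
  exact ⟨ModuleCat.ofHom ((a ^ s).liftQ (LinearMap.toSpanSingleton R M v) h'), one_smul R v⟩

theorem lamRel.zero {a : Ideal R} {I : InjectiveResolution Y} {n s : ℕ}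
    {h} (hx : lamRel a I n s 0 h) : h = 0 := by
  obtain ⟨f, hf, z, hz, rfl⟩ := hx
  rw [Submodule.Quotient.mk_eq_zero, Submodule.mem_comap]
  cases n with
  | zero =>
    rw [hf.zero_iff0.1 rfl] at hz
    exact Subtype.ext hz
  | succ n =>
    obtain ⟨g, hg⟩ := hf.zero_iff_succ.1 rfl
    refine ⟨⟨g.hom (Submodule.Quotient.mk 1), ⟨s, fun r hr => ?_⟩⟩, ?_⟩
    · rw [← map_smul, ← Submodule.Quotient.mk_smul, smul_eq_mul, mul_one,
        (Submodule.Quotient.mk_eq_zero _).2 hr, map_zero]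
    · apply Subtype.ext
      rw [← hg] at hz
      exact hz.symm

/-- transition -/
noncomputable def trA (a : Ideal R) {s t : ℕ} (hst : s ≤ t) : As a t ⟶ As a s :=
  ModuleCat.ofHom (Submodule.mapQ _ _ LinearMap.id (Ideal.pow_le_pow_right hst))

theorem lamRel.map {a : Ideal R} {I : InjectiveResolution Y} {n s t : ℕ} (hst : s ≤ t)
    {x : oExt n (As a s) Y} {h} (hx : lamRel a I n s x h) :
    lamRel a I n t ((((Ext R (ModuleCat.{u} R) n).map (trA a hst).op).app Y).hom x) h := by
  obtain ⟨f, hf, z, hz, rfl⟩ := hx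
  exact ⟨_, hf.map _, z, hz, rfl⟩

theorem lamRel.surj {a : Ideal R} {I : InjectiveResolution Y} {n : ℕ} (h : HI a I n) :
    ∃ s x, lamRel a I n s x h := by
  obtain ⟨z, rfl⟩ := Submodule.Quotient.mk_surjective _ h
  obtain ⟨s, hs⟩ := z.1.2
  obtain ⟨f, hf⟩ := As_lift z.1.1 hs
  obtain ⟨x, hx⟩ := ERel.exists' I f (As_ext _ _ (by
    have : (I.cocomplex.d n (n + 1)).hom z.1.1 = 0 :=
      congrArg Subtype.val (LinearMap.mem_ker.1 z.2)
    rw [← hf] at this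
    exact this))
  exact ⟨s, x, f, hx, z, hf.symm, rfl⟩

theorem lamRel.ker {a : Ideal R} {I : InjectiveResolution Y} {n s : ℕ} {x : oExt n (As a s) Y}
    (hx : lamRel a I n s x 0) : ∃ (t : ℕ) (hst : s ≤ t),
      (((Ext R (ModuleCat.{u} R) n).map (trA a hst).op).app Y).hom x = 0 := by
  obtain ⟨f, hf, z, hz, h⟩ := hx
  rw [eq_comm, Submodule.Quotient.mk_eq_zero, Submodule.mem_comap] at h
  cases n with
  | zero =>
    have h' : z.1 = 0 := h
    refine ⟨s, le_rfl, (hf.map _).zero_iff0.2 ?_⟩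
    have : f = 0 := As_ext _ _ (by rw [← hz, h']; rfl)
    rw [this, Limits.comp_zero]
  | succ n =>
    obtain ⟨y, hy⟩ := h
    obtain ⟨t, ht⟩ := y.2
    obtain ⟨g, hg⟩ := As_lift (s := s + t) y.1
      (fun r hr => ht r (Ideal.pow_le_pow_right (by omega) hr))
    refine ⟨s + t, by omega, (hf.map _).zero_iff_succ.2 ⟨g, As_ext _ _ ?_⟩⟩
    have h1 : (I.cocomplex.d n (n + 1)).hom y.1 = z.1.1 := congrArg Subtype.val hy
    rw [← hg, hz] at h1
    exact h1

theorem lcoh_equiv (a : Ideal R) (I : InjectiveResolution Y) (n : ℕ) :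
    Nonempty (Paper.lcoh R a n Y ≃ₗ[R] HI a I n) := by
  have hL : ∀ s, ∃ L : oExt n (As a s) Y →ₗ[R] HI a I n, ∀ x y, lamRel a I n s x y ↔ y = L x :=
    fun s => linear_of_rel _ (lamRel.total a I n s) (fun _ _ _ _ => lamRel.add)
      (fun r _ _ => lamRel.smul r) (fun _ => lamRel.zero)
  choose L hL using hL
  let c := (((evaluation _ _).obj Y).mapCocone (Limits.colimit.cocone
    (localCohomology.diagram (localCohomology.idealPowersDiagram a) n)))
  have hc : Limits.IsColimit c := Limits.isColimitOfPreserves _ (Limits.colimit.isColimit _)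
  let c' : Limits.Cocone (localCohomology.diagram (localCohomology.idealPowersDiagram a) n ⋙
      (evaluation _ _).obj Y) :=
    { pt := ModuleCat.of R (HI a I n)
      ι := { app := fun s => ModuleCat.ofHom (L s.unop.unop)
             naturality := by
              intro s t hst
              ext x
              have h1 := ((hL s.unop.unop x _).2 rfl).map (leOfHom hst.unop.unop)
              exact ((hL _ _ _).1 h1).symm } }
  let Λ : c.pt →ₗ[R] HI a I n := (hc.desc c').hom
  have hΛ : ∀ s x, Λ ((c.ι.app s).hom x) = L s.unop.unop x := by
    intro s x
    exact congrArg (fun g => g.hom x) (hc.fac c' s)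
  refine ⟨LinearEquiv.ofBijective Λ ⟨?_, ?_⟩⟩
  · rw [injective_iff_map_eq_zero]
    intro x hx
    obtain ⟨s, y, rfl⟩ := colim_rep hc x
    rw [hΛ] at hx
    obtain ⟨t, hst, ht⟩ := ((hL s.unop.unop y 0).2 hx.symm).ker
    have h2 := c.w (Quiver.Hom.op (Quiver.Hom.op (homOfLE hst)) : s ⟶ op (op t))
    have h3 := congrArg (fun g => g.hom y) h2
    refine h3.symm.trans ?_
    exact (congrArg (c.ι.app (op (op t))).hom ht).trans (map_zero _)
  · intro h
    obtain ⟨s, x, hx⟩ := lamRel.surj h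
    exact ⟨(c.ι.app (op (op s))).hom x, (hΛ _ _).trans ((hL _ _ _).1 hx).symm⟩

end lc
end GH

namespace GH

section cx
variable {R : Type u} [CommRing R]

theorem cores_mono {P Q : ModuleCat.{u} R → Prop} (h : ∀ M, P M → Q M) (k : ℕ) :
    ∀ M, Paper.CoresDimLE R P k M → Paper.CoresDimLE R Q k M := by
  induction k with
  | zero => exact h
  | succ k ih =>
    rintro M (h1 | ⟨X, f, hX, hf, h2⟩)
    · exact Or.inl (ih _ h1)
    · exact Or.inr ⟨X, f, h _ hX, hf, ih _ h2⟩

theorem coresDim_ne_top {P : ModuleCat.{u} R → Prop} {M : ModuleCat.{u} R} :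
    Paper.CoresDim R P M ≠ ⊤ ↔ ∃ k, Paper.CoresDimLE R P k M := by
  constructor
  · intro h
    by_contra h2
    push Not at h2
    refine h ?_
    unfold Paper.CoresDim
    rw [sInf_eq_top]
    rintro _ ⟨k, -, hk⟩
    exact (h2 k hk).elim
  · rintro ⟨k, hk⟩ h
    unfold Paper.CoresDim at h
    rw [sInf_eq_top] at h
    exact ENat.natCast_ne_top k (h _ ⟨k, rfl, hk⟩)

theorem fid_of_cores (k : ℕ) : ∀ M : ModuleCat.{u} R,
    Paper.CoresDimLE R (fun N => Module.Injective R N) k M → FID R M := by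
  induction k with
  | zero => exact fun M h => FID.of_inj h
  | succ k ih =>
    rintro M (h1 | ⟨X, f, hX, hf, h2⟩)
    · exact ih _ h1
    · have hs : SES f (LinearMap.range f).mkQ :=
        ⟨hf, LinearMap.exact_map_mkQ_range f, Submodule.mkQ_surjective _⟩
      exact hs.fid₁ (FID.of_inj hX) (ih _ h2)

theorem cores_of_lt (k : ℕ) : ∀ M : ModuleCat.{u} R, HasInjectiveDimensionLT M (k + 1) →
    Paper.CoresDimLE R (fun N => Module.Injective R N) k M := by
  induction k with
  | zero =>
    intro M h
    exact (Module.injective_iff_injective_object R M).2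
      (injective_iff_hasInjectiveDimensionLT_one.2 h)
  | succ k ih =>
    intro M h
    have hX : Module.Injective R (Injective.under M : ModuleCat.{u} R) :=
      (Module.injective_iff_injective_object R _).2 (Injective.injective_under M)
    have hf : Function.Injective (Injective.ι M).hom :=
      (ModuleCat.mono_iff_injective (Injective.ι M)).1 inferInstance
    refine Or.inr ⟨Injective.under M, (Injective.ι M).hom, hX, hf, ih _ ?_⟩
    have hs : SES (Injective.ι M).hom (LinearMap.range (Injective.ι M).hom).mkQ :=
        ⟨hf, LinearMap.exact_map_mkQ_range _, Submodule.mkQ_surjective _⟩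
    have h1 : HasInjectiveDimensionLT (Injective.under M) 1 :=
      injective_iff_hasInjectiveDimensionLT_one.1 inferInstance
    exact hs.short.hasInjectiveDimensionLT_X₃ (k + 1)
      (hasInjectiveDimensionLT_of_ge (Injective.under M) 1 _ (by omega)) h

theorem fid_iff_cores (M : ModuleCat.{u} R) :
    FID R M ↔ ∃ k, Paper.CoresDimLE R (fun N => Module.Injective R N) k M := by
  constructor
  · rintro ⟨n, hn⟩
    have hn : HasInjectiveDimensionLT M n := hn
    exact ⟨n, cores_of_lt n M (hasInjectiveDimensionLT_of_ge M n _ (by omega))⟩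
  · rintro ⟨k, hk⟩
    exact fid_of_cores k M hk

theorem gi_of_inj (J : ModuleCat.{u} R) (hJ : Module.Injective R J) :
    Paper.IsGorensteinInjective R J := by
  classical
  refine ⟨fun _ => J, fun i => if Even i then 0 else LinearMap.id, fun _ => hJ, ?_, ?_,
    LinearMap.id, fun _ _ h => h, ?_⟩
  · intro i
    by_cases hi : Even i
    · have : ¬ Even (i + 1) := by rw [Int.even_add_one]; simpa using hi
      intro x
      simp [hi, this, eq_comm]
    · have : Even (i + 1) := by rw [Int.even_add_one]; exact hi
      intro x
      simp [hi, this]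
  · intro I _ i g hg
    by_cases hi : Even i
    · have : ¬ Even (i + 1) := by rw [Int.even_add_one]; simpa using hi
      simp only [this, if_false, LinearMap.id_comp] at hg
      exact ⟨0, by rw [hg]; simp⟩
    · exact ⟨g, by simp [hi]⟩
  · intro x
    simp

theorem gid_of_fid (M : ModuleCat.{u} R) (h : FID R M) : Paper.GinjDim R M ≠ ⊤ := by
  obtain ⟨k, hk⟩ := (fid_iff_cores M).1 h
  exact coresDim_ne_top.2 ⟨k, cores_mono gi_of_inj k _ hk⟩

theorem gor_iff : Paper.IsGorensteinRing R ↔ FID R R :=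
  coresDim_ne_top.trans (fid_iff_cores (ModuleCat.of R R)).symm

variable {T : ℕ → Type u} [∀ i, AddCommGroup (T i)] [∀ i, Module R (T i)]
    {δ : ∀ i, T i →ₗ[R] T (i + 1)}

theorem bd_inj (hT : ∀ i, Module.Injective R (T i)) (n : ℕ)
    (h : ∀ i, i < n → LinearMap.ker (δ i) = Bd δ i) :
    ∀ i, i ≤ n → Module.Injective R (Bd δ i) := by
  intro i
  induction i with
  | zero =>
    intro _
    have : Subsingleton (Bd δ 0) := inferInstanceAs (Subsingleton (⊥ : Submodule R (T 0)))
    exact ⟨fun A B _ _ _ _ f hf g => ⟨0, fun x => Subsingleton.elim _ _⟩⟩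
  | succ i ih =>
    intro hi
    show Module.Injective R (LinearMap.range (δ i))
    refine inj_quot (ih (by omega)) (hT i) (Bd δ i).subtype (δ i).rangeRestrict
      (Submodule.injective_subtype _) ?_ (LinearMap.surjective_rangeRestrict _)
    rw [LinearMap.exact_iff, LinearMap.ker_rangeRestrict, h i hi, Submodule.range_subtype]

/-- the map to the next kernel -/
def nextK (hz : ∀ i x, δ (i + 1) (δ i x) = 0) (j : ℕ) :
    T j →ₗ[R] LinearMap.ker (δ (j + 1)) := (δ j).codRestrict _ (fun x => hz j x)

theorem nextK_ses (hz : ∀ i x, δ (i + 1) (δ i x) = 0) (j : ℕ)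
    (he : Function.Exact (δ j) (δ (j + 1))) :
    SES (LinearMap.ker (δ j)).subtype (nextK hz j) := by
  refine ⟨Submodule.injective_subtype _, ?_, ?_⟩
  · rw [LinearMap.exact_iff, Submodule.range_subtype]
    exact LinearMap.ker_codRestrict _ _ _
  · rintro ⟨y, hy⟩
    obtain ⟨x, rfl⟩ := (he y).1 hy
    exact ⟨x, rfl⟩

theorem kerinj_of_fid (hT : ∀ i, Module.Injective R (T i)) (hz : ∀ i x, δ (i + 1) (δ i x) = 0)
    (n : ℕ) (he : ∀ i, n ≤ i → Function.Exact (δ i) (δ (i + 1)))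
    (h : FID R (LinearMap.ker (δ n))) :
    ∃ N, n ≤ N ∧ ∀ j, N ≤ j → Module.Injective R (LinearMap.ker (δ j)) := by
  obtain ⟨k, hk⟩ := h
  have key : ∀ l m j, n ≤ j → l + 1 ≤ m + 1 → 
      HasInjectiveDimensionLT (ModuleCat.of R (LinearMap.ker (δ j))) (l + 1) →
      Module.Injective R (LinearMap.ker (δ (j + m))) := by
    intro l m
    induction m generalizing l with
    | zero =>
      intro j _ hl h
      obtain rfl : l = 0 := by omega
      exact (Module.injective_iff_injective_object R _).2
        (injective_iff_hasInjectiveDimensionLT_one.2 h)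
    | succ m ih =>
      intro j hj hl h
      rw [show j + (m + 1) = (j + 1) + m by omega]
      have hs := nextK_ses hz j (he j hj)
      have h1 : HasInjectiveDimensionLT (ModuleCat.of R (T j)) 1 :=
        injective_iff_hasInjectiveDimensionLT_one.1
          ((Module.injective_iff_injective_object R _).1 (hT j))
      rcases l with _ | l
      · refine ih 0 (j + 1) (by omega) (by omega) ?_
        exact hs.short.hasInjectiveDimensionLT_X₃ 1 h1
          (hasInjectiveDimensionLT_of_ge (ModuleCat.of R (LinearMap.ker (δ j))) 1 _ (by omega))
      · refine ih l (j + 1) (by omega) (by omega) ?_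
        exact hs.short.hasInjectiveDimensionLT_X₃ (l + 1)
          (hasInjectiveDimensionLT_of_ge (ModuleCat.of R (T j)) 1 _ (by omega)) h
  refine ⟨n + k, by omega, fun j hj => ?_⟩
  obtain ⟨m, rfl⟩ := Nat.exists_eq_add_of_le (show n ≤ j by omega)
  exact key k m n le_rfl (by omega) (hasInjectiveDimensionLT_of_ge _ k _ (by omega))

theorem fid_of_kerinj (hT : ∀ i, Module.Injective R (T i)) (hz : ∀ i x, δ (i + 1) (δ i x) = 0)
    (n : ℕ) (he : ∀ i, n ≤ i → Function.Exact (δ i) (δ (i + 1)))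
    (m : ℕ) (h : Module.Injective R (LinearMap.ker (δ (n + m)))) :
    FID R (LinearMap.ker (δ n)) := by
  have key : ∀ l, l ≤ m → FID R (LinearMap.ker (δ (n + (m - l)))) := by
    intro l
    induction l with
    | zero => exact fun _ => FID.of_inj h
    | succ l ih =>
      intro hl
      have := ih (by omega)
      rw [show n + (m - l) = (n + (m - (l + 1))) + 1 by omega] at this
      exact (nextK_ses hz _ (he _ (by omega))).fid₁ (FID.of_inj (hT _)) this
  have := key m le_rfl
  rwa [show n + (m - m) = n by omega] at this

end cx
end GH

namespace GH

section rel
variable {R : Type u} [CommRing R] {Y : ModuleCat.{u} R} (a : Ideal R) (I : InjectiveResolution Y)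

/-- boundaries of the torsion complex -/
noncomputable abbrev BI (n : ℕ) : Submodule R (TI a I n) := Bd (T := fun i => TI a I i) (Td a I) n

theorem dd_zero (i : ℕ) (x : I.cocomplex.X i) :
    (I.cocomplex.d (i + 1) (i + 1 + 1)).hom ((I.cocomplex.d i (i + 1)).hom x) = 0 := by
  rw [← LinearMap.comp_apply, ← ModuleCat.hom_comp, I.cocomplex.d_comp_d]
  rfl

theorem Td_zero (i : ℕ) (x : TI a I i) : Td a I (i + 1) (Td a I i x) = 0 :=
  Subtype.ext (dd_zero I i x.1)

theorem BI_le (n : ℕ) : BI a I n ≤ LinearMap.ker (Td a I n) := by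
  cases n with
  | zero => exact bot_le
  | succ n =>
    rintro _ ⟨x, rfl⟩
    exact Td_zero a I n x

theorem ker_of_sub (n : ℕ) (h : Subsingleton (HI a I n)) :
    LinearMap.ker (Td a I n) = BI a I n := by
  refine le_antisymm ?_ (BI_le a I n)
  rw [Submodule.Quotient.subsingleton_iff] at h
  exact Submodule.comap_subtype_eq_top.1 h

theorem TI_inj [IsNoetherianRing R] (i : ℕ) : Module.Injective R (TI a I i) :=
  tors_inj a ((Module.injective_iff_injective_object R _).2 (I.injective i))

/-- the inclusion of boundaries -/
noncomputable abbrev incl (n : ℕ) : BI a I n →ₗ[R] LinearMap.ker (Td a I n) :=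
  Submodule.inclusion (BI_le a I n)

/-- the projection to cohomology -/
noncomputable abbrev proj (n : ℕ) : LinearMap.ker (Td a I n) →ₗ[R] HI a I n := Submodule.mkQ _

theorem HI_ses (n : ℕ) : SES (incl a I n) (proj a I n) := by
  refine ⟨Submodule.inclusion_injective _, ?_, Submodule.mkQ_surjective _⟩
  rw [LinearMap.exact_iff, Submodule.ker_mkQ, Submodule.range_inclusion]

theorem HI_section (n : ℕ) (hB : Module.Injective R (BI a I n)) :
    ∃ s : HI a I n →ₗ[R] LinearMap.ker (Td a I n), (proj a I n).comp s = LinearMap.id := by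
  have h := HI_ses a I n
  obtain ⟨r, hr⟩ := hB.out (incl a I n) h.inj LinearMap.id
  refine ⟨Submodule.liftQ _ (LinearMap.id - (incl a I n).comp r) ?_, ?_⟩
  · intro x hx
    have hx : (proj a I n) x = 0 := (Submodule.Quotient.mk_eq_zero _).2 hx
    obtain ⟨y, rfl⟩ := (h.exact x).1 hx
    simp [hr]
  · refine Submodule.linearMap_qext _ ?_
    ext x
    change proj a I n (x - incl a I n (r x)) = proj a I n x
    rw [map_sub, h.exact.apply_apply_eq_zero, sub_zero]

theorem HI_fid (n : ℕ) (hB : Module.Injective R (BI a I n)) :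
    FID R (HI a I n) ↔ FID R (LinearMap.ker (Td a I n)) :=
  ⟨fun h => (HI_ses a I n).fid₂ (FID.of_inj hB) h, fun h => (HI_ses a I n).fid₃ (FID.of_inj hB) h⟩

end rel

section main
variable {R : Type u} [CommRing R] [IsNoetherianRing R] (a : Ideal R)
  (I : InjectiveResolution (ModuleCat.of R R)) (n : ℕ)

theorem relcm_ker (h : Paper.IsRelCM R a n R) (i : ℕ) (hi : i ≠ n) :
    LinearMap.ker (Td a I i) = BI a I i := by
  obtain ⟨e⟩ := lcoh_equiv a I i
  have := h.1 i hi
  exact ker_of_sub a I i e.symm.toEquiv.subsingleton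

theorem relcm_exact (h : Paper.IsRelCM R a n R) (i : ℕ) (hi : n ≤ i) :
    Function.Exact (Td a I i) (Td a I (i + 1)) := by
  rw [LinearMap.exact_iff]
  exact relcm_ker a I n h (i + 1) (by omega)

theorem relcm_bd (h : Paper.IsRelCM R a n R) : Module.Injective R (BI a I n) :=
  bd_inj (T := fun i => TI a I i) (TI_inj a I) n (fun i hi => relcm_ker a I n h i (by omega)) n
    le_rfl

theorem gid_of_gor (hR : FID R R) (h : Paper.IsRelCM R a n R) :
    Paper.GinjDim R (Paper.lcoh R a n R) ≠ ⊤ := by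
  let I : InjectiveResolution (ModuleCat.of R R) := injectiveResolution _
  refine gid_of_fid _ ?_
  obtain ⟨e⟩ := lcoh_equiv a I n
  refine FID.equiv ?_ e.symm
  rw [HI_fid a I n (relcm_bd a I n h)]
  obtain ⟨ε, hI⟩ := IRes.of_res I
  have h0 : FID R (LinearMap.ker (I.cocomplex.d 0 1).hom) := by
    refine FID.equiv hR ((LinearEquiv.ofInjective ε hI.ε_inj).trans (LinearEquiv.ofEq _ _ ?_))
    exact (LinearMap.exact_iff.1 hI.exact0).symm
  obtain ⟨N, -, hN⟩ := kerinj_of_fid (T := fun i => I.cocomplex.X i)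
    (δ := fun i => (I.cocomplex.d i (i + 1)).hom) hI.inj (dd_zero I) 0 (fun i _ => hI.exact i) h0
  refine fid_of_kerinj (T := fun i => TI a I i) (δ := Td a I) (TI_inj a I) (Td_zero a I) n
    (fun i hi => relcm_exact a I n h i hi) N ?_
  have := tors_inj a (hN (n + N) (by omega))
  refine inj_of_equiv this ?_
  refine LinearEquiv.ofLinearMap
    (LinearMap.codRestrict _ (torsMap a (Submodule.subtype _)) ?_)
    (LinearMap.codRestrict _ (LinearMap.codRestrict _ ((Submodule.subtype _).comp
      (Submodule.subtype _)) ?_) ?_) ?_ ?_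
  · intro x
    exact Subtype.ext x.1.2
  · intro x
    exact congrArg Subtype.val x.2
  · intro x
    obtain ⟨k, hk⟩ := x.1.2
    exact ⟨k, fun r hr => Subtype.ext (hk r hr)⟩
  · ext x; rfl
  · ext x; rfl

theorem kerinj_of_gid (h : Paper.IsRelCM R a n R)
    (hG : Paper.GinjDim R (Paper.lcoh R a n R) ≠ ⊤) :
    ∃ N, n ≤ N ∧ ∀ j, N ≤ j → Module.Injective R (LinearMap.ker (Td a I j)) := by
  obtain ⟨k, hk⟩ := coresDim_ne_top.1 hG
  obtain ⟨G, C, i, p, hs, hGc, hC⟩ := embed_of_cores k _ hk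
  obtain ⟨e⟩ := lcoh_equiv a I n
  obtain ⟨ε, hI⟩ := IRes.of_res I
  have hz : ∀ z, z ∈ BI a I n → True := fun _ _ => trivial
  have hB := relcm_bd a I n h
  obtain ⟨s, hsec⟩ := HI_section a I n hB
  have hs' : SES (i.comp e.symm.toLinearMap) p := by
    refine ⟨hs.inj.comp e.symm.injective, ?_, hs.surj⟩
    intro y
    rw [hs.exact y]
    constructor
    · rintro ⟨x, rfl⟩; exact ⟨e x, by simp⟩
    · rintro ⟨x, rfl⟩; exact ⟨e.symm x, rfl⟩
  obtain ⟨J, q, ψ, hJ, hq⟩ := lift_cocycle (T := fun i => TI a I i) (δ := Td a I)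
    (contr_tors_dsum a hI) n (fun i hi => relcm_exact a I n h i hi) hGc
    ((i.comp e.symm.toLinearMap).comp (proj a I n)) (by
      intro z hz
      have : proj a I n z = 0 := (Submodule.Quotient.mk_eq_zero _).2 hz
      rw [LinearMap.comp_apply, this, map_zero])
  have hfid : FID R (HI a I n) := by
    refine fid_of_factor hs' hC hJ (ψ.comp s) q ?_
    rw [← LinearMap.comp_assoc, hq, LinearMap.comp_assoc, hsec, LinearMap.comp_id]
  rw [HI_fid a I n hB] at hfid
  exact kerinj_of_fid (T := fun i => TI a I i) (δ := Td a I) (TI_inj a I) (Td_zero a I) n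
    (fun i hi => relcm_exact a I n h i hi) hfid

theorem relcm_bot [Nontrivial R] : Paper.IsRelCM R (⊥ : Ideal R) 0 R := by
  let I : InjectiveResolution (ModuleCat.of R R) := injectiveResolution _
  obtain ⟨ε, hI⟩ := IRes.of_res I
  have htop : ∀ i (x : I.cocomplex.X i), x ∈ torsI (⊥ : Ideal R) (I.cocomplex.X i) := by
    intro i x
    refine ⟨1, fun r hr => ?_⟩
    rw [pow_one] at hr
    rw [(Submodule.mem_bot R).1 hr, zero_smul]
  constructor
  · intro i hi
    obtain ⟨e⟩ := lcoh_equiv ⊥ I i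
    have : Subsingleton (HI ⊥ I i) := by
      rw [Submodule.Quotient.subsingleton_iff, Submodule.comap_subtype_eq_top]
      obtain ⟨i, rfl⟩ := Nat.exists_eq_succ_of_ne_zero hi
      intro x hx
      obtain ⟨y, hy⟩ := (hI.exact i x.1).1 (congrArg Subtype.val hx)
      exact ⟨⟨y, htop i y⟩, Subtype.ext hy⟩
    exact e.toEquiv.subsingleton
  · intro hs
    obtain ⟨e⟩ := lcoh_equiv ⊥ I 0
    have h1 : Subsingleton (HI ⊥ I 0) := e.symm.toEquiv.subsingleton
    have h2 := ker_of_sub ⊥ I 0 h1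
    have h3 : (⟨ε 1, htop 0 _⟩ : TI ⊥ I 0) ∈ LinearMap.ker (Td ⊥ I 0) :=
      Subtype.ext (hI.exact0.apply_apply_eq_zero 1)
    rw [h2] at h3
    have h4 := congrArg Subtype.val ((Submodule.mem_bot R).1 h3)
    exact one_ne_zero (hI.ε_inj (h4.trans (map_zero ε).symm))

end main
end GH

namespace GH

section bass
variable {R : Type u} [CommRing R]

/-- vanishing of Ext of a cyclic module -/
def EV (J : Ideal R) (i : ℕ) : Prop :=
  Subsingleton (Abelian.Ext (ModuleCat.of R (R ⧸ J)) (ModuleCat.of R R) i)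

theorem ev_of_kerinj (a : Ideal R) (I : InjectiveResolution (ModuleCat.of R R)) (j : ℕ)
    (he : Function.Exact (Td a I j) (Td a I (j + 1)))
    (hj : Module.Injective R (LinearMap.ker (Td a I j))) (J : Ideal R) (haJ : a ≤ J) :
    EV J (j + 1) := by
  refine subsingleton_of_forall_eq 0 fun α => ?_
  obtain ⟨f, hf, rfl⟩ := I.extMk_surjective α (j + 2) rfl
  rw [I.extMk_eq_zero_iff f (j + 2) rfl hf j rfl]
  have hft : ∀ x, f.hom x ∈ torsI a (I.cocomplex.X (j + 1)) := by
    intro x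
    obtain ⟨x, rfl⟩ := Submodule.Quotient.mk_surjective _ x
    refine ⟨1, fun r hr => ?_⟩
    rw [pow_one] at hr
    rw [← map_smul, ← Submodule.Quotient.mk_smul, (Submodule.Quotient.mk_eq_zero _).2, map_zero]
    rw [smul_eq_mul]
    exact J.mul_mem_right _ (haJ hr)
  have hfz : ∀ x, (I.cocomplex.d (j + 1) (j + 2)).hom (f.hom x) = 0 := by
    intro x
    rw [← LinearMap.comp_apply, ← ModuleCat.hom_comp, hf]
    rfl
  let F : (R ⧸ J) →ₗ[R] LinearMap.ker (Td a I (j + 1)) :=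
    LinearMap.codRestrict _ (LinearMap.codRestrict _ f.hom hft) (fun x => Subtype.ext (hfz x))
  have hs := nextK_ses (T := fun i => TI a I i) (Td_zero a I) j he
  obtain ⟨r, hr⟩ := hj.out _ hs.inj LinearMap.id
  -- section of nextK
  obtain ⟨s, hs2⟩ : ∃ s : LinearMap.ker (Td a I (j + 1)) →ₗ[R] TI a I j,
      ∀ y, Td a I j (s y) = y.1 := by
    let e := (LinearMap.quotKerEquivOfSurjective _ hs.surj)
    let s0 : (TI a I j ⧸ LinearMap.ker (nextK (T := fun i => TI a I i) (Td_zero a I) j)) →ₗ[R]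
        TI a I j := Submodule.liftQ _ (LinearMap.id - (Submodule.subtype _).comp r) (by
          intro x hx
          obtain ⟨y, rfl⟩ := (hs.exact x).1 hx
          rw [LinearMap.mem_ker, LinearMap.sub_apply, LinearMap.comp_apply, hr]
          exact sub_self _)
    refine ⟨s0.comp e.symm.toLinearMap, fun y => ?_⟩
    obtain ⟨x, rfl⟩ := hs.surj y
    have : e.symm (nextK (T := fun i => TI a I i) (Td_zero a I) j x) = Submodule.Quotient.mk x := by
      rw [LinearEquiv.symm_apply_eq]; rfl
    rw [LinearMap.comp_apply, LinearEquiv.coe_coe, this]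
    change Td a I j (x - (r x).1) = Td a I j x
    rw [map_sub, LinearMap.mem_ker.1 (r x).2, sub_zero]
  refine ⟨ModuleCat.ofHom ((Submodule.subtype _).comp (s.comp F)), ?_⟩
  ext
  exact congrArg Subtype.val (hs2 (F (Submodule.Quotient.mk 1)))

/-- multiplication on cyclic modules -/
def mulQ (x : R) (K J : Ideal R) (h : ∀ r, r ∈ K ↔ x * r ∈ J) : (R ⧸ K) →ₗ[R] (R ⧸ J) :=
  Submodule.mapQ K J (LinearMap.mulLeft R x) (fun r hr => (h r).1 hr)

theorem cyc_ses (x : R) (K J : Ideal R) (h : ∀ r, r ∈ K ↔ x * r ∈ J) :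
    SES (mulQ x K J h) (Submodule.mapQ J (J ⊔ Ideal.span {x}) LinearMap.id le_sup_left) := by
  refine ⟨?_, ?_, ?_⟩
  · rw [injective_iff_map_eq_zero]
    intro y hy
    obtain ⟨y, rfl⟩ := Submodule.Quotient.mk_surjective _ y
    exact (Submodule.Quotient.mk_eq_zero _).2 ((h y).2 ((Submodule.Quotient.mk_eq_zero _).1 hy))
  · intro y
    obtain ⟨y, rfl⟩ := Submodule.Quotient.mk_surjective _ y
    constructor
    · intro hy
      have hy : y ∈ J ⊔ Ideal.span {x} := (Submodule.Quotient.mk_eq_zero _).1 hy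
      obtain ⟨u, hu, v, hv, rfl⟩ := Submodule.mem_sup.1 hy
      obtain ⟨c, rfl⟩ := Ideal.mem_span_singleton'.1 hv
      refine ⟨Submodule.Quotient.mk c, ?_⟩
      change Submodule.Quotient.mk (x * c) = _
      rw [eq_comm, Submodule.Quotient.eq]
      convert hu using 1
      ring
    · rintro ⟨c, hc⟩
      obtain ⟨c, rfl⟩ := Submodule.Quotient.mk_surjective _ c
      rw [← hc]
      refine (Submodule.Quotient.mk_eq_zero _).2 ?_
      exact Ideal.mem_sup_right (Ideal.mul_mem_right _ _ (Ideal.mem_span_singleton_self x))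
  · intro y
    obtain ⟨y, rfl⟩ := Submodule.Quotient.mk_surjective _ y
    exact ⟨Submodule.Quotient.mk y, rfl⟩

theorem ev_all [IsNoetherianRing R] [IsLocalRing R] (N : ℕ)
    (hm : ∀ i, N ≤ i → EV (maximalIdeal R) i) :
    ∀ J : Ideal R, ∀ i, N ≤ i → EV J i := by
  intro J
  induction J using IsNoetherian.induction with
  | hgt J ih =>
  change Ideal R at J
  intro i hi
  by_cases hT : J = ⊤
  · subst hT
    have h0 : Limits.IsZero (ModuleCat.of R (R ⧸ (⊤ : Ideal R))) :=
      ModuleCat.isZero_of_subsingleton _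
    refine subsingleton_of_forall_eq 0 fun α => ?_
    rw [← Abelian.Ext.mk₀_id_comp α, h0.eq_of_src (𝟙 _) 0, Abelian.Ext.mk₀_zero,
      Abelian.Ext.zero_comp]
  by_cases hP : J.IsPrime
  · by_cases hJm : J = maximalIdeal R
    · subst hJm; exact hm i hi
    obtain ⟨x, hxm, hxJ⟩ : ∃ x ∈ maximalIdeal R, x ∉ J := by
      by_contra hc
      push Not at hc
      exact hJm (le_antisymm (IsLocalRing.le_maximalIdeal hT) hc)
    have hK : ∀ r, r ∈ J ↔ x * r ∈ J :=
      fun r => ⟨fun h => J.mul_mem_left _ h, fun h => (hP.mem_or_mem h).resolve_left hxJ⟩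
    have hs := cyc_ses x J J hK
    have hlt : J < J ⊔ Ideal.span {x} := by
      refine lt_of_le_of_ne le_sup_left fun h => hxJ ?_
      rw [h]
      exact Ideal.mem_sup_right (Ideal.mem_span_singleton_self x)
    have hf : ModuleCat.ofHom (mulQ x J J hK) = x • 𝟙 (ModuleCat.of R (R ⧸ J)) := by
      ext; rfl
    have hsub : Subsingleton (Abelian.Ext hs.cplx.X₃ (ModuleCat.of R R) (i + 1)) :=
      ih _ hlt (i + 1) (by omega)
    have hdiv : ∀ α : Abelian.Ext (ModuleCat.of R (R ⧸ J)) (ModuleCat.of R R) i,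
        ∃ β, x • β = α := by
      intro α
      obtain ⟨β, hβ⟩ := Abelian.Ext.contravariant_sequence_exact₁ hs.short
        (ModuleCat.of R R) α (add_comm 1 i) (Subsingleton.elim _ _)
      refine ⟨β, ?_⟩
      refine Eq.trans ?_ hβ
      change x • β = (Abelian.Ext.mk₀ (ModuleCat.ofHom (mulQ x J J hK))).comp β (zero_add i)
      rw [hf, Abelian.Ext.mk₀_smul, Abelian.Ext.smul_comp, Abelian.Ext.mk₀_id_comp]
    have hfin : Module.Finite R (Abelian.Ext (ModuleCat.of R (R ⧸ J)) (ModuleCat.of R R) i) :=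
      ModuleCat.finite_ext R (ModuleCat.of R (R ⧸ J)) (ModuleCat.of R R) i
    have := Submodule.eq_bot_of_le_smul_of_le_jacobson_bot (maximalIdeal R)
      (⊤ : Submodule R (Abelian.Ext (ModuleCat.of R (R ⧸ J)) (ModuleCat.of R R) i))
      hfin.fg_top (by
        intro α _
        obtain ⟨β, rfl⟩ := hdiv α
        exact Submodule.smul_mem_smul hxm trivial) (IsLocalRing.maximalIdeal_le_jacobson _)
    exact subsingleton_of_forall_eq 0 fun α => (Submodule.mem_bot R).1 (this ▸ trivial)
  · obtain ⟨x, y, hx, hy, hxy⟩ : ∃ x y, x ∉ J ∧ y ∉ J ∧ x * y ∈ J := by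
      by_contra hc
      push Not at hc
      refine hP ⟨hT, fun {x y} hxy => ?_⟩
      by_contra h2
      exact hc x y (fun h => h2 (Or.inl h)) (fun h => h2 (Or.inr h)) hxy
    let K : Ideal R := Submodule.comap (LinearMap.mulLeft R x) J
    have hK : ∀ r, r ∈ K ↔ x * r ∈ J := fun r => Iff.rfl
    have hs := cyc_ses x K J hK
    have hlt : J < J ⊔ Ideal.span {x} := by
      refine lt_of_le_of_ne le_sup_left fun h => hx ?_
      rw [h]
      exact Ideal.mem_sup_right (Ideal.mem_span_singleton_self x)
    have hltK : J < K := by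
      refine lt_of_le_of_ne (fun r hr => J.mul_mem_left _ hr) fun h => hy ?_
      rw [h]
      exact hxy
    have h1 : Subsingleton (Abelian.Ext hs.cplx.X₃ (ModuleCat.of R R) i) := ih _ hlt i hi
    have h2 : Subsingleton (Abelian.Ext hs.cplx.X₁ (ModuleCat.of R R) i) := ih _ hltK i hi
    refine subsingleton_of_forall_eq 0 fun α => ?_
    obtain ⟨β, hβ⟩ := Abelian.Ext.contravariant_sequence_exact₂ hs.short
        (ModuleCat.of R R) α (Subsingleton.elim _ _)
    rw [← hβ, Subsingleton.elim β 0, Abelian.Ext.comp_zero]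

theorem fid_of_ev (N : ℕ) (h : ∀ J : Ideal R, EV J (N + 1)) : FID R R := by
  let I : InjectiveResolution (ModuleCat.of R R) := injectiveResolution _
  obtain ⟨ε, hI⟩ := IRes.of_res I
  suffices h0 : FID R (LinearMap.ker (I.cocomplex.d 0 1).hom) by
    refine FID.equiv h0 ((LinearEquiv.ofInjective ε hI.ε_inj).trans (LinearEquiv.ofEq _ _ ?_)).symm
    exact (LinearMap.exact_iff.1 hI.exact0).symm
  refine fid_of_kerinj (T := fun i => I.cocomplex.X i)
    (δ := fun i => (I.cocomplex.d i (i + 1)).hom) hI.inj (dd_zero I) 0 (fun i _ => hI.exact i) N ?_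
  rw [Nat.zero_add]
  refine Module.Baer.injective ?_
  intro J g
  obtain ⟨G, hG⟩ := (hI.inj N).out J.subtype (Submodule.injective_subtype _)
    ((Submodule.subtype _).comp g)
  have hle : J ≤ LinearMap.ker ((I.cocomplex.d N (N + 1)).hom.comp G) := by
    intro r hr
    have := hG ⟨r, hr⟩
    rw [LinearMap.mem_ker, LinearMap.comp_apply]
    change G r = _ at this
    rw [this]
    exact (g ⟨r, hr⟩).2
  let f : ModuleCat.of R (R ⧸ J) ⟶ I.cocomplex.X (N + 1) :=
    ModuleCat.ofHom (Submodule.liftQ J _ hle)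
  have hf : f ≫ I.cocomplex.d (N + 1) (N + 2) = 0 := by
    ext
    exact dd_zero I N (G 1)
  have hJ : Subsingleton (Abelian.Ext (ModuleCat.of R (R ⧸ J)) (ModuleCat.of R R) (N + 1)) := h J
  obtain ⟨k, hk⟩ := (I.extMk_eq_zero_iff f (N + 2) rfl hf N rfl).1
    (Subsingleton.elim _ _)
  have hk' : ∀ r : R, (I.cocomplex.d N (N + 1)).hom (k.hom (Submodule.Quotient.mk r)) =
      (I.cocomplex.d N (N + 1)).hom (G r) := fun r =>
    LinearMap.congr_fun (congrArg ModuleCat.Hom.hom hk) (Submodule.Quotient.mk r)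
  refine ⟨LinearMap.codRestrict _ (G - k.hom.comp J.mkQ) ?_, ?_⟩
  · intro r
    rw [LinearMap.mem_ker, LinearMap.sub_apply, map_sub]
    exact sub_eq_zero.2 (hk' r).symm
  · intro r hr
    refine Subtype.ext ?_
    change G r - k.hom (Submodule.Quotient.mk r) = _
    rw [(Submodule.Quotient.mk_eq_zero _).2 hr, map_zero, sub_zero]
    exact hG ⟨r, hr⟩

end bass

theorem main_aux (R : Type u) [CommRing R] [IsNoetherianRing R] [IsLocalRing R] (a : Ideal R)
    (n : ℕ) (ha : a ≠ ⊤) (h : Paper.IsRelCM R a n R)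
    (hG : Paper.GinjDim R (Paper.lcoh R a n R) ≠ ⊤) : Paper.IsGorensteinRing R := by
  let I : InjectiveResolution (ModuleCat.of R R) := injectiveResolution _
  obtain ⟨N, hnN, hN⟩ := kerinj_of_gid a I n h hG
  refine gor_iff.2 (fid_of_ev N fun J => ev_all (N + 1) (fun i hi => ?_) J (N + 1) le_rfl)
  obtain ⟨j, rfl⟩ := Nat.exists_eq_add_of_le' hi
  have := ev_of_kerinj a I (j + N) (relcm_exact a I n h _ (by omega)) (hN _ (by omega))
    (maximalIdeal R) (IsLocalRing.le_maximalIdeal ha)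
  exact this

end GH

open Paper IsLocalRing

/-- **Corollary 3.6.** A Noetherian local ring `R` is Gorenstein iff `Gid_R H^n_𝔞(R)` is
finite for all proper ideals `𝔞` such that `R` is relative Cohen-Macaulay with respect to
`𝔞` with `ht_R 𝔞 = n`, iff the same holds for some such ideal. -/
theorem isGorenstein_iff_GinjDim_localCohomology
    (R : Type u) [CommRing R] [IsNoetherianRing R] [IsLocalRing R] :
    ((IsGorensteinRing R ↔
        ∀ (𝔞 : Ideal R) (n : ℕ), 𝔞 ≠ ⊤ → IsRelCM R 𝔞 n R →
          GinjDim R (lcoh R 𝔞 n R) ≠ ⊤) ∧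
     ((∀ (𝔞 : Ideal R) (n : ℕ), 𝔞 ≠ ⊤ → IsRelCM R 𝔞 n R →
          GinjDim R (lcoh R 𝔞 n R) ≠ ⊤) ↔
        ∃ (𝔞 : Ideal R) (n : ℕ), 𝔞 ≠ ⊤ ∧ IsRelCM R 𝔞 n R ∧
          GinjDim R (lcoh R 𝔞 n R) ≠ ⊤)) := by
  have h12 : IsGorensteinRing R → ∀ (𝔞 : Ideal R) (n : ℕ), 𝔞 ≠ ⊤ → IsRelCM R 𝔞 n R →
      GinjDim R (lcoh R 𝔞 n R) ≠ ⊤ :=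
    fun h 𝔞 n _ hn => GH.gid_of_gor 𝔞 n (GH.gor_iff.1 h) hn
  have h23 : (∀ (𝔞 : Ideal R) (n : ℕ), 𝔞 ≠ ⊤ → IsRelCM R 𝔞 n R →
      GinjDim R (lcoh R 𝔞 n R) ≠ ⊤) → ∃ (𝔞 : Ideal R) (n : ℕ), 𝔞 ≠ ⊤ ∧ IsRelCM R 𝔞 n R ∧
        GinjDim R (lcoh R 𝔞 n R) ≠ ⊤ :=
    fun h => ⟨⊥, 0, bot_ne_top, GH.relcm_bot, h ⊥ 0 bot_ne_top GH.relcm_bot⟩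
  have h31 : (∃ (𝔞 : Ideal R) (n : ℕ), 𝔞 ≠ ⊤ ∧ IsRelCM R 𝔞 n R ∧
      GinjDim R (lcoh R 𝔞 n R) ≠ ⊤) → IsGorensteinRing R := by
    rintro ⟨𝔞, n, ha, hn, hG⟩
    exact GH.main_aux R 𝔞 n ha hn hG
  exact ⟨⟨h12, fun h => h31 (h23 h)⟩, ⟨h23, fun h => h12 (h31 h)⟩⟩
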